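/- Let G be a Jordan domain, z₀ ∈ G, let (K_n)_{n≥0} be the area orthonormal polynomials of G, and let φ : G → {w : |w| < R₀} be the normalized conformal map with φ(z₀) = 0 and φ'(z₀) = 1. Then for every z ∈ G the series Σ_{k=0}^{∞} conj(K_k(z₀)) K_k(z) converges and its sum equals φ'(z)/(π R₀²). -/

import Mathlib

open MeasureTheory Filter

/-- A Jordan domain: a bounded simply connected open subset of `ℂ` whose
boundary is a Jordan curve (the image of an injective continuous map of the
unit circle). -/
def IsJordanDomain (G : Set ℂ) : Prop :=
  IsOpen G ∧ Bornology.IsBounded G ∧ SimplyConnectedSpace G ∧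
    ∃ γ : C(Metric.sphere (0 : ℂ) 1, ℂ),
      Function.Injective γ ∧ Set.range γ = frontier G

/-- The area orthonormal polynomials of `G`: `K n` has exact degree `n`,
positive leading coefficient, and `∫∫_G K_m conj(K_n) = δ_{mn}`. -/
def AreaOrthonormalPolys (G : Set ℂ) (K : ℕ → Polynomial ℂ) : Prop :=
  (∀ n, (K n).natDegree = n) ∧
  (∀ n, ∃ a : ℝ, 0 < a ∧ (K n).leadingCoeff = (a : ℂ)) ∧
  (∀ m n, (∫ z in G, (K m).eval z * (starRingEnd ℂ) ((K n).eval z)) =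
      if m = n then (1 : ℂ) else 0)

open scoped ENNReal

/-- There is no continuous logarithm of `z - o` near infinity. -/
theorem not_exists_log_sub_const (o : ℂ) (M : ℝ) (L : ℂ → ℂ) (hL : Continuous L)
    (h : ∀ z : ℂ, M < ‖z‖ → Complex.exp (L z) = z - o) : False := by
  obtain ⟨R, hR0, hR⟩ : ∃ R : ℝ, 0 < R ∧ M + ‖o‖ < R :=
    ⟨max 0 (M + ‖o‖) + 1, by positivity, by linarith [le_max_right 0 (M + ‖o‖)]⟩
  set c : ℝ → ℂ := fun t => o + R * Complex.exp (t * Complex.I)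
  have hc : ∀ t, Complex.exp (L (c t)) = R * Complex.exp (t * Complex.I) := by
    intro t
    rw [h]
    · simp [c]
    · have h1 : ‖(R : ℂ) * Complex.exp (t * Complex.I)‖ = R := by
        simp [Complex.norm_exp_ofReal_mul_I, abs_of_pos hR0]
      have h2 := norm_sub_norm_le ((R : ℂ) * Complex.exp (t * Complex.I)) (-o)
      rw [h1, norm_neg, sub_neg_eq_add, add_comm _ o] at h2
      show M < ‖c t‖
      simp only [c]
      linarith
  set l : ℝ → ℂ := fun t => L (c t) - t * Complex.I
  have hlc : Continuous l := by
    have : Continuous c := by fun_prop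
    exact (hL.comp this).sub (by fun_prop)
  have hl : ∀ t, Complex.exp (l t) = R := by
    intro t
    simp only [l]
    rw [Complex.exp_sub, hc, mul_div_assoc, div_self (Complex.exp_ne_zero _), mul_one]
  have hconst : l = fun _ => l 0 := by
    refine Complex.isCoveringMap_exp.eq_of_comp_eq hlc continuous_const ?_ 0 rfl
    ext t
    simp [hl]
  have h1 := congrFun hconst (2 * Real.pi)
  have h2 : c (2 * Real.pi) = c 0 := by
    simp only [c]; push_cast; simp
  simp only [l, h2] at h1
  have : (2 * Real.pi : ℂ) * Complex.I = 0 := by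
    push_cast at h1
    linear_combination -h1
  simp [Real.pi_ne_zero] at this

/-- Every frontier point of a domain `G` bounded by a Jordan curve lies in the closure of any set
`Ω` disjoint from `G` that contains a neighbourhood of infinity and has its frontier on the
curve. -/
theorem frontier_subset_closure_of_jordan {G Ω : Set ℂ} (hG : IsOpen G) (hne : G.Nonempty)
    (γ : C(Metric.sphere (0 : ℂ) 1, ℂ)) (hγ : Function.Injective γ)
    (hγG : Set.range γ = frontier G) (hdisj : Disjoint Ω G)
    (hfr : frontier Ω ⊆ frontier G) {M : ℝ} (hM : ∀ z : ℂ, M < ‖z‖ → z ∈ Ω) :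
    frontier G ⊆ closure Ω := by
  intro ζ hζ
  by_contra hζΩ
  obtain ⟨o, ho⟩ := hne
  have hemb := γ.continuous.isClosedEmbedding hγ
  set J := frontier G
  obtain ⟨t₀, rfl⟩ : ζ ∈ Set.range γ := hγG ▸ hζ
  -- angular coordinate on the frontier of `Ω`
  let e := hemb.isEmbedding.toHomeomorph
  have hA : ∀ x : frontier Ω, (x : ℂ) ∈ Set.range γ := fun x => hγG ▸ hfr x.2
  let s : frontier Ω → Metric.sphere (0 : ℂ) 1 := fun x => e.symm ⟨x, hA x⟩
  have hs : ∀ x, γ (s x) = x := fun x => by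
    have := e.apply_symm_apply ⟨x, hA x⟩
    exact congrArg Subtype.val this
  have hscont : Continuous s := e.symm.continuous.comp (by fun_prop)
  have ht₀ : (t₀ : ℂ) ≠ 0 := by
    intro h0; have := t₀.2; simp [h0] at this
  have hst : ∀ x, (s x : ℂ) ≠ t₀ := by
    intro x hx
    have : s x = t₀ := Subtype.ext hx
    apply hζΩ
    rw [← this, hs]
    exact frontier_subset_closure x.2
  have hnorm : ∀ x, ‖-(s x : ℂ) / t₀‖ = 1 := by
    intro x
    have h1 : ‖(s x : ℂ)‖ = 1 := by simp
    have h2 : ‖(t₀ : ℂ)‖ = 1 := by simp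
    simp [h1, h2]
  have hslit : ∀ x, -(s x : ℂ) / t₀ ∈ Complex.slitPlane := by
    intro x
    rw [Complex.mem_slitPlane_iff_arg]
    refine ⟨fun harg => ?_, fun h0 => by have := hnorm x; simp [h0] at this⟩
    apply hst x
    have := Complex.norm_mul_exp_arg_mul_I (-(s x : ℂ) / t₀)
    rw [hnorm, harg, Complex.exp_pi_mul_I] at this
    field_simp at this
    simpa using this.symm
  let Θ : C(frontier Ω, ℝ) := ⟨fun x => Complex.arg (-(s x : ℂ) / t₀), by
    rw [continuous_iff_continuousAt]
    intro x
    exact ContinuousAt.comp (f := fun x => -(s x : ℂ) / t₀)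
      (Complex.continuousAt_arg (hslit x)) (by fun_prop)⟩
  obtain ⟨Θ', hΘ'⟩ := Θ.exists_restrict_eq isClosed_frontier
  let ρ : ℂ → Metric.sphere (0 : ℂ) 1 := fun z =>
    ⟨-t₀ * Complex.exp (Θ' z * Complex.I), by
      have h2 : ‖(t₀ : ℂ)‖ = 1 := by simp
      simp [Complex.norm_exp_ofReal_mul_I, h2]⟩
  have hρ : Continuous ρ := by
    apply Continuous.subtype_mk
    fun_prop
  have hρs : ∀ x ∈ frontier Ω, γ (ρ x) = x := by
    intro x hx
    refine Eq.trans (congrArg γ (Subtype.ext ?_)) (hs ⟨x, hx⟩)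
    show -(t₀ : ℂ) * Complex.exp (Θ' x * Complex.I) = s ⟨x, hx⟩
    have h1 : Θ' x = Complex.arg (-(s ⟨x, hx⟩ : ℂ) / t₀) :=
      congrArg (fun f : C(frontier Ω, ℝ) => f ⟨x, hx⟩) hΘ'
    have := Complex.norm_mul_exp_arg_mul_I (-(s ⟨x, hx⟩ : ℂ) / t₀)
    rw [hnorm] at this
    rw [h1]
    simp only [Complex.ofReal_one, one_mul] at this
    rw [this]
    field_simp
  classical
  let q : ℂ → ℂ := fun z => if z ∈ closure Ω then z else γ (ρ z)
  have hq : Continuous q := by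
    refine continuous_if ?_ continuousOn_id (γ.continuous.comp hρ).continuousOn
    intro x hx
    exact (hρs x (frontier_closure_subset hx)).symm
  have hoJ : o ∉ J := fun h => by
    have : o ∈ frontier G := h
    rw [hG.frontier_eq] at this
    exact this.2 ho
  have hoΩ : o ∉ closure Ω := fun h => by
    obtain ⟨y, hy1, hy2⟩ := mem_closure_iff.1 h G hG ho
    exact hdisj.le_bot ⟨hy2, hy1⟩
  have hqo : ∀ z, q z - o ≠ 0 := by
    intro z hz
    have hz : q z = o := sub_eq_zero.1 hz
    by_cases hzΩ : z ∈ closure Ω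
    · simp only [q, if_pos hzΩ] at hz
      exact hoΩ (hz ▸ hzΩ)
    · simp only [q, if_neg hzΩ] at hz
      exact hoJ (hγG ▸ ⟨_, hz⟩)
  obtain ⟨L, hLc, hL⟩ := Complex.exists_continuousOn_eqOn_exp_comp (U := (Set.univ : Set ℂ))
    (g := fun z => q z - o) (by
      have : SimplyConnectedSpace (Set.univ : Set ℂ) :=
        (Homeomorph.Set.univ ℂ).toHomotopyEquiv.simplyConnectedSpace
      exact this) isOpen_univ (hq.sub continuous_const).continuousOn
    (by rintro ⟨z, -, hz⟩; exact hqo z hz)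
  refine not_exists_log_sub_const o M L (continuousOn_univ.1 hLc) fun z hz => ?_
  have := hL (Set.mem_univ z)
  simp only [Function.comp_apply, q, if_pos (subset_closure (hM z hz))] at this
  exact this

theorem isConnected_compl_closedBall_zero {M : ℝ} (hM : 0 < M) :
    IsConnected (Metric.closedBall (0 : ℂ) M)ᶜ := by
  have h : (Metric.closedBall (0 : ℂ) M)ᶜ = Complex.exp '' {z | Real.log M < z.re} := by
    ext z
    simp only [Set.mem_compl_iff, mem_closedBall_zero_iff, not_le, Set.mem_image, Set.mem_ofPred_eq]
    constructor
    · intro hz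
      have h0 : z ≠ 0 := norm_pos_iff.1 (hM.trans hz)
      exact ⟨Complex.log z, by rw [Complex.log_re]; exact Real.log_lt_log hM hz,
        Complex.exp_log h0⟩
    · rintro ⟨w, hw, rfl⟩
      rw [Complex.norm_exp]
      exact (Real.log_lt_iff_lt_exp hM).1 hw
  rw [h]
  refine IsConnected.image ⟨⟨((Real.log M + 1 : ℝ) : ℂ), ?_⟩, ?_⟩ _
    Complex.continuous_exp.continuousOn
  · simp
  · exact (convex_halfSpace_re_gt _).isPreconnected

/-- The unbounded component of the complement of the closure of a domain bounded by a Jordan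
curve. -/
theorem exists_exterior_domain {G : Set ℂ} (hG : IsOpen G) (hne : G.Nonempty)
    (hb : Bornology.IsBounded G)
    (hJ : ∃ γ : C(Metric.sphere (0 : ℂ) 1, ℂ), Function.Injective γ ∧ Set.range γ = frontier G) :
    ∃ Ω : Set ℂ, IsOpen Ω ∧ IsConnected Ω ∧ Disjoint Ω (closure G) ∧
      (∃ M : ℝ, ∀ z : ℂ, M < ‖z‖ → z ∈ Ω) ∧ frontier G ⊆ closure Ω := by
  obtain ⟨γ, hγ, hγG⟩ := hJ
  obtain ⟨M, hM1, hM⟩ := hb.closure.subset_closedBall_lt 0 0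
  have hMc : (Metric.closedBall (0 : ℂ) M)ᶜ ⊆ (closure G)ᶜ := Set.compl_subset_compl.2 hM
  have hconn : IsConnected (Metric.closedBall (0 : ℂ) M)ᶜ :=
    isConnected_compl_closedBall_zero hM1
  obtain ⟨w, hw⟩ := hconn.nonempty
  have hUo : IsOpen (closure G)ᶜ := isClosed_closure.isOpen_compl
  set Ω := connectedComponentIn (closure G)ᶜ w
  have hΩo : IsOpen Ω := hUo.connectedComponentIn
  have hΩs : Ω ⊆ (closure G)ᶜ := connectedComponentIn_subset _ _
  have hdisj : Disjoint Ω (closure G) := Set.disjoint_left.2 fun x hx => hΩs hx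
  have hfar : ∀ z : ℂ, M < ‖z‖ → z ∈ Ω := fun z hz =>
    hconn.isPreconnected.subset_connectedComponentIn hw hMc (by simpa using hz)
  have hfr : frontier Ω ⊆ frontier G := by
    intro x hx
    rw [hΩo.frontier_eq] at hx
    rw [hG.frontier_eq]
    constructor
    · by_contra hxG
      have hxo : IsOpen (connectedComponentIn (closure G)ᶜ x) := hUo.connectedComponentIn
      obtain ⟨y, hy1, hy2⟩ := mem_closure_iff.1 hx.1 _ hxo (mem_connectedComponentIn hxG)
      apply hx.2
      have h1 := connectedComponentIn_eq hy1
      have h2 := connectedComponentIn_eq hy2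
      show x ∈ connectedComponentIn (closure G)ᶜ w
      rw [h2, ← h1]
      exact mem_connectedComponentIn hxG
    · intro hxG
      obtain ⟨y, hy1, hy2⟩ := mem_closure_iff.1 hx.1 G hG hxG
      exact hΩs hy2 (subset_closure hy1)
  exact ⟨Ω, hΩo, isConnected_connectedComponentIn_iff.2 (hMc hw), hdisj, ⟨M, hfar⟩,
    frontier_subset_closure_of_jordan hG hne γ hγ hγG
      (hdisj.mono_right subset_closure) hfr hfar⟩

theorem integral_eq_zero_of_circleAverage_eq_zero {F : ℂ → ℂ} {a : ℂ}
    (h : ∀ r : ℝ, 0 < r → Real.circleAverage F a r = 0) : ∫ z, F z = 0 := by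
  rw [← integral_add_left_eq_self F a, ← Complex.integral_comp_polarCoord_symm]
  rw [show polarCoord.target = Set.Ioi (0 : ℝ) ×ˢ Set.Ioo (-Real.pi) Real.pi from rfl]
  by_cases h_int : IntegrableOn (fun p : ℝ × ℝ => p.1 • F (a + Complex.polarCoord.symm p))
    (Set.Ioi (0 : ℝ) ×ˢ Set.Ioo (-Real.pi) Real.pi) (volume.prod volume)
  · rw [Measure.volume_eq_prod, setIntegral_prod _ h_int]
    refine setIntegral_eq_zero_of_forall_eq_zero fun r hr => ?_
    have hr' : 0 < r := hr
    have h1 := h r hr'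
    rw [Real.circleAverage_def, smul_eq_zero] at h1
    have h2 : ∫ θ in (0 : ℝ)..2 * Real.pi, F (circleMap a r θ) = 0 :=
      h1.resolve_left (by positivity)
    have h3 : Function.Periodic (fun θ => F (circleMap a r θ)) (2 * Real.pi) :=
      fun θ => by simp only [periodic_circleMap a r θ]
    have h4 := h3.intervalIntegral_add_eq (-Real.pi) 0
    rw [zero_add, h2, show -Real.pi + 2 * Real.pi = Real.pi by ring,
      intervalIntegral.integral_of_le (by linarith [Real.pi_pos]),
      integral_Ioc_eq_integral_Ioo] at h4
    rw [integral_smul]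
    convert smul_zero r using 2
    rw [← h4]
    refine integral_congr_ae (Eventually.of_forall fun θ => ?_)
    simp only [Complex.polarCoord_symm_apply, circleMap, Complex.exp_mul_I]
    push_cast
    ring_nf
  · exact integral_undef h_int

theorem setIntegral_radial_mul_eq_zero {a : ℂ} {R : ℝ} {g : ℂ → ℂ} (k : ℝ → ℝ)
    (hg : DifferentiableOn ℂ g (Metric.ball a R)) (ga : g a = 0) :
    ∫ z in Metric.ball a R, (k ‖z - a‖ : ℂ) * g z = 0 := by
  rw [← integral_indicator Metric.isOpen_ball.measurableSet]
  refine integral_eq_zero_of_circleAverage_eq_zero (a := a) fun r hr => ?_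
  by_cases hrR : r < R
  · have h1 : Real.circleAverage g a r = 0 := by
      rw [← ga]
      refine DiffContOnCl.circleAverage ((hg.mono ?_).diffContOnCl)
      rw [abs_of_pos hr]
      exact Metric.closure_ball_subset_closedBall.trans (Metric.closedBall_subset_ball hrR)
    have h2 : Real.circleAverage (fun z => (k r : ℂ) • g z) a r = 0 := by
      rw [Real.circleAverage_fun_smul, h1, smul_zero]
    rw [← h2]
    refine Real.circleAverage_congr_sphere fun z hz => ?_
    have hz' : ‖z - a‖ = r := by simpa [abs_of_pos hr, dist_eq_norm] using hz
    rw [Set.indicator_of_mem (by rw [Metric.mem_ball, dist_eq_norm]; linarith)]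
    simp [hz']
  · rw [show (0 : ℂ) = Real.circleAverage (fun _ : ℂ => (0 : ℂ)) a r by
      simp [Real.circleAverage_def]]
    refine Real.circleAverage_congr_sphere fun z hz => ?_
    have hz' : ‖z - a‖ = r := by simpa [abs_of_pos hr, dist_eq_norm] using hz
    rw [Set.indicator_of_notMem (by rw [Metric.mem_ball, dist_eq_norm]; linarith)]

theorem setIntegral_radial_mul {a : ℂ} {R : ℝ} {f : ℂ → ℂ} (k : ℝ → ℝ)
    (hf : DifferentiableOn ℂ f (Metric.ball a R))
    (hk : IntegrableOn (fun z => (k ‖z - a‖ : ℂ)) (Metric.ball a R))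
    (hkf : IntegrableOn (fun z => (k ‖z - a‖ : ℂ) * f z) (Metric.ball a R)) :
    ∫ z in Metric.ball a R, (k ‖z - a‖ : ℂ) * f z =
      f a * ∫ z in Metric.ball a R, (k ‖z - a‖ : ℂ) := by
  have h := setIntegral_radial_mul_eq_zero k (g := fun z => f z - f a)
    (hf.sub_const _) (sub_self _)
  simp_rw [mul_sub] at h
  rw [integral_sub hkf (hk.mul_const _), integral_mul_const] at h
  rw [sub_eq_zero.1 h, mul_comm]

/-- Twice the Wirtinger derivative `∂/∂z̄`. -/
noncomputable def dbar (u : ℂ → ℂ) (w : ℂ) : ℂ :=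
  fderiv ℝ u w 1 + Complex.I * fderiv ℝ u w Complex.I

theorem Filter.EventuallyEq.dbar_eq {u v : ℂ → ℂ} {w : ℂ} (h : u =ᶠ[nhds w] v) :
    dbar u w = dbar v w := by
  simp only [dbar, h.fderiv_eq]

theorem dbar_eq_zero_of_differentiableAt {u : ℂ → ℂ} {w : ℂ} (h : DifferentiableAt ℂ u w) :
    dbar u w = 0 := by
  simp only [dbar, h.fderiv_restrictScalars ℝ, ContinuousLinearMap.coe_restrictScalars']
  have : fderiv ℂ u w Complex.I = Complex.I * fderiv ℂ u w 1 := by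
    rw [← smul_eq_mul, ← map_smul, smul_eq_mul, mul_one]
  rw [this, ← mul_assoc, Complex.I_mul_I]; ring

theorem dbar_mul {u v : ℂ → ℂ} {w : ℂ} (hu : DifferentiableAt ℝ u w)
    (hv : DifferentiableAt ℝ v w) : dbar (fun z => u z * v z) w = u w * dbar v w + dbar u w * v w := by
  simp only [dbar, fderiv_fun_mul hu hv]
  simp
  ring

/-- A smooth step vanishing below `δ² / 2` and equal to one above `δ²`. -/
noncomputable def smoothStep (δ s : ℝ) : ℝ := Real.smoothTransition (2 * s / δ ^ 2 - 1)

theorem contDiff_smoothStep (δ : ℝ) {n : ℕ∞} : ContDiff ℝ n (smoothStep δ) :=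
  Real.smoothTransition.contDiff.comp (by fun_prop)

theorem monotone_smoothStep (δ : ℝ) : Monotone (smoothStep δ) := by
  intro s t hst
  apply Real.smoothTransition.monotone
  gcongr

theorem smoothStep_eq_zero {δ s : ℝ} (hδ : 0 < δ) (hs : s ≤ δ ^ 2 / 2) : smoothStep δ s = 0 := by
  apply Real.smoothTransition.zero_of_nonpos
  rw [sub_nonpos, div_le_one (by positivity)]
  linarith

theorem smoothStep_eq_one {δ s : ℝ} (hδ : 0 < δ) (hs : δ ^ 2 ≤ s) : smoothStep δ s = 1 := by
  apply Real.smoothTransition.one_of_one_le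
  rw [le_sub_iff_add_le, le_div_iff₀ (by positivity)]
  linarith

theorem hasDerivAt_smoothStep (δ s : ℝ) :
    HasDerivAt (smoothStep δ) (deriv (smoothStep δ) s) s :=
  ((contDiff_smoothStep δ (n := 1)).differentiable (by simp)).differentiableAt.hasDerivAt

/-- The Cauchy kernel smoothed at scale `δ`. -/
noncomputable def smoothCauchy (δ : ℝ) (w : ℂ) : ℂ := (smoothStep δ (‖w‖ ^ 2) : ℂ) * w⁻¹

/-- The radial bump that is the `dbar` derivative of `smoothCauchy`. -/
noncomputable def radialBump (δ : ℝ) (r : ℝ) : ℝ := 2 * deriv (smoothStep δ) (r ^ 2)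

theorem smoothCauchy_eq_inv {δ : ℝ} (hδ : 0 < δ) {w : ℂ} (hw : δ ≤ ‖w‖) :
    smoothCauchy δ w = w⁻¹ := by
  rw [smoothCauchy, smoothStep_eq_one hδ (by gcongr)]; simp

theorem smoothCauchy_eventuallyEq_zero {δ : ℝ} (hδ : 0 < δ) :
    smoothCauchy δ =ᶠ[nhds 0] 0 := by
  have : ∀ᶠ w : ℂ in nhds 0, ‖w‖ ^ 2 < δ ^ 2 / 2 :=
    (by fun_prop : Continuous fun w : ℂ => ‖w‖ ^ 2).continuousAt.eventually_lt
      continuousAt_const (by simp; positivity)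
  filter_upwards [this] with w hw
  simp [smoothCauchy, smoothStep_eq_zero hδ hw.le]

theorem contDiff_smoothStep_norm (δ : ℝ) {n : ℕ∞} :
    ContDiff ℝ n (fun w : ℂ => (smoothStep δ (‖w‖ ^ 2) : ℂ)) :=
  Complex.ofRealCLM.contDiff.comp ((contDiff_smoothStep δ).comp (contDiff_norm_sq ℝ))

theorem contDiff_smoothCauchy {δ : ℝ} (hδ : 0 < δ) {n : ℕ∞} : ContDiff ℝ n (smoothCauchy δ) := by
  rw [contDiff_iff_contDiffAt]
  intro w
  by_cases hw : w = 0
  · subst hw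
    exact contDiffAt_const.congr_of_eventuallyEq (smoothCauchy_eventuallyEq_zero hδ)
  · exact (contDiff_smoothStep_norm δ).contDiffAt.mul (contDiffAt_inv ℝ hw)

theorem dbar_smoothCauchy {δ : ℝ} (hδ : 0 < δ) (w : ℂ) :
    dbar (smoothCauchy δ) w = radialBump δ ‖w‖ := by
  by_cases hw : w = 0
  · subst hw
    rw [(smoothCauchy_eventuallyEq_zero hδ).dbar_eq]
    have : deriv (smoothStep δ) 0 = 0 := by
      have : smoothStep δ =ᶠ[nhds 0] fun _ => 0 := by
        filter_upwards [Iio_mem_nhds (show (0 : ℝ) < δ ^ 2 / 2 by positivity)] with s hs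
        exact smoothStep_eq_zero hδ (le_of_lt hs)
      rw [this.deriv_eq, deriv_const]
    simp [dbar, radialBump, this]
  · have h1 : HasFDerivAt (fun z : ℂ => smoothStep δ (‖z‖ ^ 2))
        (deriv (smoothStep δ) (‖w‖ ^ 2) • (2 • (innerSL ℝ w))) w :=
      HasDerivAt.comp_hasFDerivAt (h₂ := smoothStep δ) (f := fun z : ℂ => ‖z‖ ^ 2) w
        (hasDerivAt_smoothStep δ (‖w‖ ^ 2)) (hasStrictFDerivAt_norm_sq w).hasFDerivAt
    have h2 := (Complex.ofRealCLM.hasFDerivAt.comp w h1)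
    have h3 : dbar (fun z : ℂ => (smoothStep δ (‖z‖ ^ 2) : ℂ)) w =
        radialBump δ ‖w‖ * w := by
      have h4 : fderiv ℝ (fun z : ℂ => (smoothStep δ (‖z‖ ^ 2) : ℂ)) w = _ := h2.fderiv
      simp only [dbar, h4, radialBump]
      apply Complex.ext <;> simp [innerSL_apply_apply, Complex.inner] <;> ring
    have h5 : dbar (fun z : ℂ => z⁻¹) w = 0 :=
      dbar_eq_zero_of_differentiableAt (differentiableAt_inv hw)
    have h6 := dbar_mul (w := w) h2.differentiableAt
      (v := fun z => z⁻¹) ((differentiableAt_inv hw (𝕜 := ℂ)).restrictScalars ℝ)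
    have h7 : dbar (smoothCauchy δ) w = _ := h6
    rw [h7, h5]
    have h8 : dbar (Complex.ofRealCLM ∘ fun z : ℂ => smoothStep δ (‖z‖ ^ 2)) w = _ := h3
    rw [h8]
    field_simp
    simp

theorem radialBump_nonneg (δ r : ℝ) : 0 ≤ radialBump δ r := by
  have := (monotone_smoothStep δ).deriv_nonneg (x := r ^ 2)
  unfold radialBump; linarith

theorem radialBump_eq_zero {δ r : ℝ} (hδ : 0 < δ) (hr : δ < r) : radialBump δ r = 0 := by
  have : smoothStep δ =ᶠ[nhds (r ^ 2)] fun _ => 1 := by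
    filter_upwards [Ioi_mem_nhds (show δ ^ 2 < r ^ 2 by gcongr)] with s hs
    exact smoothStep_eq_one hδ (le_of_lt hs)
  rw [radialBump, this.deriv_eq]; simp

theorem continuous_radialBump (δ : ℝ) : Continuous (radialBump δ) := by
  have := (contDiff_smoothStep δ (n := 1)).continuous_deriv (by simp)
  unfold radialBump
  fun_prop

theorem hasCompactSupport_radialBump {δ : ℝ} (hδ : 0 < δ) :
    HasCompactSupport (fun w : ℂ => radialBump δ ‖w‖) := by
  refine HasCompactSupport.of_support_subset_isCompact (isCompact_closedBall (0 : ℂ) δ) ?_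
  intro w hw
  by_contra h
  exact hw (radialBump_eq_zero hδ (by simpa using h))

theorem integrable_radialBump {δ : ℝ} (hδ : 0 < δ) :
    Integrable (fun w : ℂ => radialBump δ ‖w‖) :=
  ((continuous_radialBump δ).comp continuous_norm).integrable_of_hasCompactSupport
    (hasCompactSupport_radialBump hδ)

theorem integral_radialBump {δ : ℝ} (hδ : 0 < δ) :
    ∫ w : ℂ, radialBump δ ‖w‖ = 2 * Real.pi := by
  rw [integral_fun_norm_addHaar volume (radialBump δ)]
  have h1 : ∫ y in Set.Ioi (0 : ℝ), y * radialBump δ y = 1 - smoothStep δ (0 ^ 2) := by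
    refine integral_Ioi_of_hasDerivAt_of_nonneg' (g := fun y => smoothStep δ (y ^ 2)) ?_ ?_ ?_
    · intro x _
      have := HasDerivAt.comp (h₂ := smoothStep δ) (h := fun y : ℝ => y ^ 2) x
        (hasDerivAt_smoothStep δ (x ^ 2)) (hasDerivAt_pow 2 x)
      refine this.congr_deriv ?_
      rw [radialBump]; push_cast; ring
    · intro x hx
      exact mul_nonneg (le_of_lt hx) (radialBump_nonneg δ x)
    · refine tendsto_const_nhds.congr' ?_
      filter_upwards [eventually_ge_atTop δ] with x hx
      rw [smoothStep_eq_one hδ (by gcongr)]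
  rw [smoothStep_eq_zero hδ (by simp; positivity)] at h1
  simp [h1, Complex.finrank_real_complex, Measure.real, Complex.volume_ball]

/-- The smoothed Cauchy transform of `h`. -/
noncomputable def smoothCauchyTransform (δ : ℝ) (h : ℂ → ℂ) (w : ℂ) : ℂ :=
  ∫ x, h x * smoothCauchy δ (w - x)

theorem smoothCauchyTransform_local {δ M : ℝ} {h : ℂ → ℂ} (hδ : 0 < δ) (hh : Integrable h)
    (hM : ∀ x, h x ≠ 0 → ‖x‖ ≤ M) (w₀ : ℂ) :
    ∃ v : ℂ → ℂ, ContDiff ℝ 2 v ∧ smoothCauchyTransform δ h =ᶠ[nhds w₀] v ∧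
      dbar v w₀ = ∫ x, h x * (radialBump δ ‖w₀ - x‖ : ℂ) := by
  set L : ℝ := ‖w₀‖ + 1 + |M| with hL
  have hLpos : 0 < L := by positivity
  let χ : ContDiffBump (0 : ℂ) := ⟨L, L + 1, hLpos, by linarith⟩
  let g : ℂ → ℂ := fun z => (χ z : ℂ) * smoothCauchy δ z
  have hχ1 : ∀ n : ℕ∞, ContDiff ℝ n fun z : ℂ => (χ z : ℂ) := fun n =>
    Complex.ofRealCLM.contDiff.comp χ.contDiff
  have hg : ∀ n : ℕ∞, ContDiff ℝ n g := fun n => (hχ1 n).mul (contDiff_smoothCauchy hδ)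
  have hgc : HasCompactSupport g := by
    refine HasCompactSupport.mul_right ?_
    exact χ.hasCompactSupport.comp_left (g := fun t : ℝ => (t : ℂ)) Complex.ofReal_zero
  have hgK : ∀ z, ‖z‖ < L → g =ᶠ[nhds z] smoothCauchy δ := by
    intro z hz
    filter_upwards [χ.eventuallyEq_one_of_mem_ball (x := z) (by simpa [χ] using hz)] with y hy
    simp [g, hy]
  have hnear : ∀ w, ‖w‖ < ‖w₀‖ + 1 → ∀ x, h x ≠ 0 → ‖w - x‖ < L := by
    intro w hw x hx
    have := hM x hx
    have := norm_sub_le w x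
    have := le_abs_self M
    linarith
  have hl : LocallyIntegrable h := hh.locallyIntegrable
  refine ⟨convolution h g (ContinuousLinearMap.mul ℝ ℂ) volume,
    hgc.contDiff_convolution_right _ hl (hg 2), ?_, ?_⟩
  · have : ∀ᶠ w in nhds w₀, ‖w‖ < ‖w₀‖ + 1 :=
      continuous_norm.continuousAt.eventually_lt continuousAt_const (by simp)
    filter_upwards [this] with w hw
    simp only [smoothCauchyTransform, convolution_def, ContinuousLinearMap.mul_apply']
    refine integral_congr_ae (Eventually.of_forall fun x => ?_)
    by_cases hx : h x = 0
    · simp [hx]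
    · simp only [(hgK _ (hnear w hw x hx)).self_of_nhds]
  · have hf := (hgc.hasFDerivAt_convolution_right (ContinuousLinearMap.mul ℝ ℂ) hl
      (hg 1) w₀).fderiv
    have hcf : HasCompactSupport (fderiv ℝ g) := hgc.fderiv ℝ
    have hcc : Continuous (fderiv ℝ g) := (hg 1).continuous_fderiv (by simp)
    simp only [dbar, hf]
    rw [convolution_precompR_apply _ hl hcf hcc, convolution_precompR_apply _ hl hcf hcc]
    simp only [convolution_def, ContinuousLinearMap.mul_apply']
    have h_int : ∀ v : ℂ, Integrable fun x => h x * fderiv ℝ g (w₀ - x) v := fun v =>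
      (((hcf.comp_left (g := fun T : ℂ →L[ℝ] ℂ => T v) (by simp)).convolutionExists_right
        (ContinuousLinearMap.mul ℝ ℂ) hl (by fun_prop)) w₀)
    rw [← integral_const_mul, ← integral_add (h_int 1) ((h_int _).const_mul _)]
    refine integral_congr_ae (Eventually.of_forall fun x => ?_)
    by_cases hx : h x = 0
    · simp [hx]
    · have h1 := (hgK _ (hnear w₀ (by linarith) x hx)).dbar_eq
      rw [dbar_smoothCauchy hδ] at h1
      simp only [← h1, dbar]
      ring

theorem contDiff_smoothCauchyTransform {δ M : ℝ} {h : ℂ → ℂ} (hδ : 0 < δ) (hh : Integrable h)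
    (hM : ∀ x, h x ≠ 0 → ‖x‖ ≤ M) : ContDiff ℝ 2 (smoothCauchyTransform δ h) := by
  rw [contDiff_iff_contDiffAt]
  intro w
  obtain ⟨v, hv, he, -⟩ := smoothCauchyTransform_local hδ hh hM w
  exact hv.contDiffAt.congr_of_eventuallyEq he

theorem dbar_smoothCauchyTransform {δ M : ℝ} {h : ℂ → ℂ} (hδ : 0 < δ) (hh : Integrable h)
    (hM : ∀ x, h x ≠ 0 → ‖x‖ ≤ M) (w : ℂ) :
    dbar (smoothCauchyTransform δ h) w = ∫ x, h x * (radialBump δ ‖w - x‖ : ℂ) := by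
  obtain ⟨v, -, he, hd⟩ := smoothCauchyTransform_local hδ hh hM w
  rw [he.dbar_eq, hd]

theorem smoothCauchyTransform_eq {δ : ℝ} {h : ℂ → ℂ} (hδ : 0 < δ) {w : ℂ}
    (hw : ∀ x, h x ≠ 0 → δ ≤ ‖w - x‖) :
    smoothCauchyTransform δ h w = ∫ x, h x * (w - x)⁻¹ := by
  refine integral_congr_ae (Eventually.of_forall fun x => ?_)
  by_cases hx : h x = 0
  · simp [hx]
  · simp only [smoothCauchy_eq_inv hδ (hw x hx)]

theorem continuous_fderiv_apply_of_contDiff_two {u : ℂ → ℂ} (hu : ContDiff ℝ 2 u) (v : ℂ) :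
    Continuous fun w => fderiv ℝ u w v :=
  (hu.continuous_fderiv (by simp)).clm_apply continuous_const

theorem hasCompactSupport_fderiv_apply {u : ℂ → ℂ} (hc : HasCompactSupport u) (v : ℂ) :
    HasCompactSupport fun w => fderiv ℝ u w v :=
  (hc.fderiv ℝ).comp_left (g := fun T : ℂ →L[ℝ] ℂ => T v) (by simp)

theorem integrable_fderiv_mul_fderiv {u c : ℂ → ℂ} (hu : ContDiff ℝ 2 u)
    (hc : HasCompactSupport u) (hcd : ContDiff ℝ 2 c) (v v' : ℂ) :
    Integrable fun w => fderiv ℝ u w v * fderiv ℝ c w v' :=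
  ((continuous_fderiv_apply_of_contDiff_two hu v).mul
    (continuous_fderiv_apply_of_contDiff_two hcd v')).integrable_of_hasCompactSupport
    ((hasCompactSupport_fderiv_apply hc v).mul_right)

theorem integral_fderiv_mul_fderiv {u c : ℂ → ℂ} (hu : ContDiff ℝ 2 u)
    (hc : HasCompactSupport u) (hcd : ContDiff ℝ 2 c) (v v' : ℂ) :
    ∫ w, fderiv ℝ u w v * fderiv ℝ c w v' = - ∫ w, u w * fderiv ℝ (fderiv ℝ c) w v v' := by
  have h1c : ContDiff ℝ 1 (fderiv ℝ c) := hcd.fderiv_right (by norm_num)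
  have hdv : ContDiff ℝ 1 fun w => fderiv ℝ c w v' := h1c.clm_apply contDiff_const
  have hd2 : ∀ w, fderiv ℝ (fun z => fderiv ℝ c z v') w v = fderiv ℝ (fderiv ℝ c) w v v' := by
    intro w
    have := ((h1c.differentiable (by simp)).differentiableAt (x := w)).hasFDerivAt.clm_apply
      (hasFDerivAt_const v' w)
    rw [this.fderiv]; simp
  have hcd2 : Continuous fun w => fderiv ℝ (fun z => fderiv ℝ c z v') w v :=
    (hdv.continuous_fderiv (by simp)).clm_apply continuous_const
  have := integral_mul_fderiv_eq_neg_fderiv_mul_of_integrable (μ := volume) (f := u)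
    (g := fun z => fderiv ℝ c z v') (v := v)
    (integrable_fderiv_mul_fderiv hu hc hcd v v')
    ((hu.continuous.mul hcd2).integrable_of_hasCompactSupport hc.mul_right)
    ((hu.continuous.mul hdv.continuous).integrable_of_hasCompactSupport hc.mul_right)
    (fun x _ => (hu.differentiable (by simp)).differentiableAt)
    (fun x _ => (hdv.differentiable (by simp)).differentiableAt)
  simp only [hd2] at this
  rw [this, neg_neg]

theorem integral_fderiv_mul_fderiv_comm {u c : ℂ → ℂ} (hu : ContDiff ℝ 2 u)
    (hc : HasCompactSupport u) (hcd : ContDiff ℝ 2 c) (v v' : ℂ) :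
    ∫ w, fderiv ℝ u w v * fderiv ℝ c w v' = ∫ w, fderiv ℝ u w v' * fderiv ℝ c w v := by
  rw [integral_fderiv_mul_fderiv hu hc hcd, integral_fderiv_mul_fderiv hu hc hcd]
  refine congrArg Neg.neg (integral_congr_ae (Eventually.of_forall fun w => ?_))
  have h : IsSymmSndFDerivAt ℝ c w := hcd.contDiffAt.isSymmSndFDerivAt (by simp)
  exact congrArg (u w * ·) (h.eq v v')

theorem integrable_norm_sq_fderiv {u : ℂ → ℂ} (hu : ContDiff ℝ 2 u)
    (hc : HasCompactSupport u) (v : ℂ) : Integrable fun w => ‖fderiv ℝ u w v‖ ^ 2 := by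
  have h1 : Continuous fun w => ‖fderiv ℝ u w v‖ ^ 2 :=
    (continuous_fderiv_apply_of_contDiff_two hu v).norm.pow 2
  have h2 : HasCompactSupport ((fun z : ℂ => ‖z‖ ^ 2) ∘ fun w => fderiv ℝ u w v) :=
    (hasCompactSupport_fderiv_apply hc v).comp_left (by simp)
  exact h1.integrable_of_hasCompactSupport h2

theorem fderiv_conj_comp {u : ℂ → ℂ} (hu : ContDiff ℝ 2 u) (w v : ℂ) :
    fderiv ℝ (fun z => (starRingEnd ℂ) (u z)) w v = (starRingEnd ℂ) (fderiv ℝ u w v) := by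
  have := (Complex.conjCLE.hasFDerivAt.comp w
    ((hu.differentiable (by simp)).differentiableAt (x := w)).hasFDerivAt).fderiv
  change fderiv ℝ (Complex.conjCLE ∘ u) w v = _
  rw [this]; rfl

theorem norm_add_I_mul_sq (p q : ℂ) : ‖p + Complex.I * q‖ ^ 2 = (‖p‖ ^ 2 + ‖q‖ ^ 2) +
    (Complex.I * (q * (starRingEnd ℂ) p - p * (starRingEnd ℂ) q)).re := by
  simp only [← Complex.normSq_eq_norm_sq, Complex.normSq_apply]
  simp
  ring

theorem integral_normSq_fderiv_eq {u : ℂ → ℂ} (hu : ContDiff ℝ 2 u) (hc : HasCompactSupport u) :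
    ∫ w, (‖fderiv ℝ u w 1‖ ^ 2 + ‖fderiv ℝ u w Complex.I‖ ^ 2) = ∫ w, ‖dbar u w‖ ^ 2 := by
  have hcd : ContDiff ℝ 2 fun z => (starRingEnd ℂ) (u z) := Complex.conjCLE.contDiff.comp hu
  have hi := fun v v' => integrable_fderiv_mul_fderiv hu hc hcd v v'
  have hs := integral_fderiv_mul_fderiv_comm hu hc hcd 1 Complex.I
  simp only [fderiv_conj_comp hu] at hi hs
  have hX := ((hi Complex.I 1).sub (hi 1 Complex.I)).const_mul Complex.I
  have h0 := integral_re hX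
  simp only [Pi.sub_apply] at hX h0
  rw [integral_const_mul, integral_sub (hi _ _) (hi _ _), hs] at h0
  simp only [dbar, norm_add_I_mul_sq]
  have h1 := integral_add ((integrable_norm_sq_fderiv hu hc 1).add
    (integrable_norm_sq_fderiv hu hc Complex.I)) hX.re
  simp only [sub_self, mul_zero, map_zero] at h0
  rw [h0, add_zero] at h1
  exact h1.symm

theorem lintegral_mul_sq_le {α : Type*} [MeasurableSpace α] {μ : Measure α} {f g : α → ℝ≥0∞}
    (hf : AEMeasurable f μ) (hg : AEMeasurable g μ) :
    (∫⁻ x, f x * g x ∂μ) ^ 2 ≤ (∫⁻ x, f x ^ 2 ∂μ) * ∫⁻ x, g x ^ 2 ∂μ := by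
  have h := ENNReal.lintegral_mul_le_Lp_mul_Lq μ Real.HolderConjugate.two_two hf hg
  simp only [Pi.mul_apply, ENNReal.rpow_two] at h
  calc (∫⁻ x, f x * g x ∂μ) ^ 2
      ≤ ((∫⁻ x, f x ^ 2 ∂μ) ^ (1 / 2 : ℝ) * (∫⁻ x, g x ^ 2 ∂μ) ^ (1 / 2 : ℝ)) ^ 2 := by gcongr
    _ = _ := by
      rw [mul_pow, ← ENNReal.rpow_natCast, ← ENNReal.rpow_natCast, ← ENNReal.rpow_mul,
        ← ENNReal.rpow_mul]
      norm_num

theorem lintegral_radialBump {δ : ℝ} (hδ : 0 < δ) :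
    ∫⁻ w : ℂ, ENNReal.ofReal (radialBump δ ‖w‖) = ENNReal.ofReal (2 * Real.pi) := by
  rw [← ofReal_integral_eq_lintegral_ofReal (integrable_radialBump hδ)
    (Eventually.of_forall fun w => radialBump_nonneg _ _), integral_radialBump hδ]

theorem lintegral_norm_sq_integral_radialBump_le {δ : ℝ} (hδ : 0 < δ) {h : ℂ → ℂ}
    (hm : AEStronglyMeasurable h) :
    ∫⁻ w, ‖∫ x, h x * (radialBump δ ‖w - x‖ : ℂ)‖ₑ ^ 2 ≤
      ENNReal.ofReal (2 * Real.pi) ^ 2 * ∫⁻ x, ‖h x‖ₑ ^ 2 := by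
  set e : ℂ → ℝ≥0∞ := fun w => ENNReal.ofReal (radialBump δ ‖w‖) with he
  set s : ℂ → ℝ≥0∞ := fun w => ENNReal.ofReal (Real.sqrt (radialBump δ ‖w‖)) with hs
  have hce : Measurable e :=
    (((continuous_radialBump δ).comp continuous_norm).measurable).ennreal_ofReal
  have hcs : Measurable s :=
    ((Real.continuous_sqrt.comp
      ((continuous_radialBump δ).comp continuous_norm)).measurable).ennreal_ofReal
  have hss : ∀ w, s w * s w = e w := by
    intro w
    simp only [hs, he]
    rw [← ENNReal.ofReal_mul (Real.sqrt_nonneg _), Real.mul_self_sqrt (radialBump_nonneg _ _)]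
  have h1 : ∀ w, ‖∫ x, h x * (radialBump δ ‖w - x‖ : ℂ)‖ₑ ^ 2 ≤
      (∫⁻ x, ‖h x‖ₑ ^ 2 * e (w - x)) * ENNReal.ofReal (2 * Real.pi) := by
    intro w
    have h2 : ‖∫ x, h x * (radialBump δ ‖w - x‖ : ℂ)‖ₑ ≤
        ∫⁻ x, (‖h x‖ₑ * s (w - x)) * s (w - x) := by
      refine (enorm_integral_le_lintegral_enorm _).trans (le_of_eq ?_)
      refine lintegral_congr fun x => ?_
      rw [enorm_mul, mul_assoc, hss]
      congr 1
      rw [← ofReal_norm, Complex.norm_real, Real.norm_of_nonneg (radialBump_nonneg _ _)]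
    have hsm : Measurable fun x => s (w - x) := hcs.comp (measurable_const.sub measurable_id)
    calc _ ≤ (∫⁻ x, (‖h x‖ₑ * s (w - x)) * s (w - x)) ^ 2 := by gcongr
      _ ≤ _ := lintegral_mul_sq_le (hm.enorm.mul hsm.aemeasurable) hsm.aemeasurable
      _ = (∫⁻ x, ‖h x‖ₑ ^ 2 * e (w - x)) * ∫⁻ x, e (w - x) := by
        congr 1
        · refine lintegral_congr fun x => ?_
          rw [mul_pow, sq (s _), hss]
        · refine lintegral_congr fun x => ?_
          rw [sq (s _), hss]
      _ = _ := by rw [lintegral_sub_left_eq_self (fun x => e x) w, lintegral_radialBump hδ]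
  calc _ ≤ ∫⁻ w, (∫⁻ x, ‖h x‖ₑ ^ 2 * e (w - x)) * ENNReal.ofReal (2 * Real.pi) :=
        lintegral_mono h1
    _ = (∫⁻ w, ∫⁻ x, ‖h x‖ₑ ^ 2 * e (w - x)) * ENNReal.ofReal (2 * Real.pi) :=
        lintegral_mul_const' _ _ ENNReal.ofReal_ne_top
    _ = (∫⁻ x, ∫⁻ w, ‖h x‖ₑ ^ 2 * e (w - x)) * ENNReal.ofReal (2 * Real.pi) := by
        rw [lintegral_lintegral_swap]
        exact ((hm.enorm.pow_const 2).comp_snd).mul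
          (hce.comp (measurable_fst.sub measurable_snd)).aemeasurable
    _ = (∫⁻ x, ‖h x‖ₑ ^ 2 * ENNReal.ofReal (2 * Real.pi)) * ENNReal.ofReal (2 * Real.pi) := by
        congr 1
        refine lintegral_congr fun x => ?_
        rw [lintegral_const_mul (f := fun w => e (w - x)) _
          (hce.comp (measurable_id.sub measurable_const)),
          lintegral_sub_right_eq_self (fun x => e x) x, lintegral_radialBump hδ]
    _ = _ := by
        rw [lintegral_mul_const' _ _ ENNReal.ofReal_ne_top]; ring

theorem norm_sq_apply_le (L : ℂ →L[ℝ] ℂ) (z : ℂ) :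
    ‖L z‖ ^ 2 ≤ ‖z‖ ^ 2 * (‖L 1‖ ^ 2 + ‖L Complex.I‖ ^ 2) := by
  have h : L z = z.re • L 1 + z.im • L Complex.I := by
    rw [← map_smul, ← map_smul, ← map_add]
    congr 1
    apply Complex.ext <;> simp
  have h1 : ‖L z‖ ≤ |z.re| * ‖L 1‖ + |z.im| * ‖L Complex.I‖ := by
    rw [h]
    refine (norm_add_le _ _).trans (le_of_eq ?_)
    rw [norm_smul, norm_smul, Real.norm_eq_abs, Real.norm_eq_abs]
  calc ‖L z‖ ^ 2 ≤ (|z.re| * ‖L 1‖ + |z.im| * ‖L Complex.I‖) ^ 2 := by gcongr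
    _ ≤ (|z.re| ^ 2 + |z.im| ^ 2) * (‖L 1‖ ^ 2 + ‖L Complex.I‖ ^ 2) := by
      nlinarith [sq_nonneg (|z.re| * ‖L Complex.I‖ - |z.im| * ‖L 1‖)]
    _ = _ := by
      rw [sq_abs, sq_abs, ← Complex.normSq_eq_norm_sq z, Complex.normSq_apply]; ring

theorem enorm_sub_sq_le_lintegral_circle {u : ℂ → ℂ} (hu : ContDiff ℝ 2 u) {ζ a b : ℂ} {r : ℝ}
    (hr : 0 < r) (ha : a ∈ Metric.sphere ζ r) (hb : b ∈ Metric.sphere ζ r) :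
    ‖u a - u b‖ₑ ^ 2 ≤ ENNReal.ofReal (2 * Real.pi * r ^ 2) *
      ∫⁻ θ in Set.Ioo (-Real.pi) Real.pi, ENNReal.ofReal (‖fderiv ℝ u (circleMap ζ r θ) 1‖ ^ 2 +
        ‖fderiv ℝ u (circleMap ζ r θ) Complex.I‖ ^ 2) := by
  set D : ℝ → ℂ := fun θ => fderiv ℝ u (circleMap ζ r θ) (circleMap 0 r θ * Complex.I) with hD
  have hDc : Continuous D := by
    have := hu.continuous_fderiv (by simp)
    exact (this.comp (continuous_circleMap ζ r)).clm_apply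
      ((continuous_circleMap 0 r).mul continuous_const)
  have hd : ∀ θ, HasDerivAt (fun θ => u (circleMap ζ r θ)) (D θ) θ := fun θ =>
    ((hu.differentiable (by simp)).differentiableAt.hasFDerivAt).comp_hasDerivAt θ
      (hasDerivAt_circleMap ζ r θ)
  have hpt : ∀ c ∈ Metric.sphere ζ r, ∃ θ ∈ Set.Ioc (-Real.pi) Real.pi, circleMap ζ r θ = c := by
    intro c hc
    refine ⟨Complex.arg (c - ζ), Complex.arg_mem_Ioc _, ?_⟩
    have : ‖c - ζ‖ = r := by simpa [dist_eq_norm] using hc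
    have h2 := Complex.norm_mul_exp_arg_mul_I (c - ζ)
    rw [this] at h2
    rw [circleMap, h2]; ring
  obtain ⟨α, hα, rfl⟩ := hpt a ha
  obtain ⟨β, hβ, rfl⟩ := hpt b hb
  have h1 : u (circleMap ζ r α) - u (circleMap ζ r β) = ∫ θ in β..α, D θ :=
    (intervalIntegral.integral_eq_sub_of_hasDerivAt (fun θ _ => hd θ)
      (hDc.intervalIntegrable _ _)).symm
  have h2 : ‖u (circleMap ζ r α) - u (circleMap ζ r β)‖ₑ ≤
      ∫⁻ θ in Set.Ioo (-Real.pi) Real.pi, ‖D θ‖ₑ * 1 := by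
    rw [h1]
    have h3 : ‖∫ θ in β..α, D θ‖ₑ = ‖∫ θ in Set.uIoc β α, D θ‖ₑ := by
      rw [← ofReal_norm, ← ofReal_norm, intervalIntegral.norm_intervalIntegral_eq]
    rw [h3]
    refine (enorm_integral_le_lintegral_enorm _).trans ?_
    simp only [mul_one]
    rw [← setLIntegral_congr (Ioo_ae_eq_Ioc (a := -Real.pi) (b := Real.pi)).symm]
    refine lintegral_mono_set fun θ hθ => ?_
    rcases Set.mem_uIoc.1 hθ with h | h
    · exact ⟨hβ.1.trans h.1, h.2.trans hα.2⟩
    · exact ⟨hα.1.trans h.1, h.2.trans hβ.2⟩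
  have h4 : ∀ θ, ‖D θ‖ₑ ^ 2 ≤ ENNReal.ofReal (r ^ 2) *
      ENNReal.ofReal (‖fderiv ℝ u (circleMap ζ r θ) 1‖ ^ 2 +
        ‖fderiv ℝ u (circleMap ζ r θ) Complex.I‖ ^ 2) := by
    intro θ
    rw [← ofReal_norm, ← ENNReal.ofReal_pow (norm_nonneg _), ← ENNReal.ofReal_mul (by positivity)]
    refine ENNReal.ofReal_le_ofReal ?_
    refine (norm_sq_apply_le _ _).trans (le_of_eq ?_)
    simp
  calc _ ≤ (∫⁻ θ in Set.Ioo (-Real.pi) Real.pi, ‖D θ‖ₑ * 1) ^ 2 := by gcongr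
    _ ≤ _ := lintegral_mul_sq_le hDc.enorm.measurable.aemeasurable aemeasurable_const
    _ ≤ (∫⁻ θ in Set.Ioo (-Real.pi) Real.pi, ENNReal.ofReal (r ^ 2) *
      ENNReal.ofReal (‖fderiv ℝ u (circleMap ζ r θ) 1‖ ^ 2 +
        ‖fderiv ℝ u (circleMap ζ r θ) Complex.I‖ ^ 2)) * ENNReal.ofReal (2 * Real.pi) := by
      gcongr with θ
      · exact h4 θ
      · simp
        rw [ENNReal.ofReal_add Real.pi_pos.le Real.pi_pos.le, two_mul]
    _ = _ := by
      rw [lintegral_const_mul' _ _ ENNReal.ofReal_ne_top,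
        ENNReal.ofReal_mul (p := 2 * Real.pi) (by positivity)]
      ring

/-- The Courant–Lebesgue lemma. -/
theorem exists_circle_oscillation_le {u : ℂ → ℂ} (hu : ContDiff ℝ 2 u) {E ρ₁ ρ₂ ε : ℝ}
    (hE : ∫⁻ w, ENNReal.ofReal (‖fderiv ℝ u w 1‖ ^ 2 + ‖fderiv ℝ u w Complex.I‖ ^ 2) ≤
      ENNReal.ofReal E) (hρ₁ : 0 < ρ₁) (hρ : ρ₁ < ρ₂) (hε : 0 < ε)
    (hlog : 2 * Real.pi * E < ε ^ 2 * Real.log (ρ₂ / ρ₁)) (ζ : ℂ) :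
    ∃ r ∈ Set.Ioo ρ₁ ρ₂, ∀ a ∈ Metric.sphere ζ r, ∀ b ∈ Metric.sphere ζ r, ‖u a - u b‖ ≤ ε := by
  by_contra! hcon
  set g : ℂ → ℝ≥0∞ := fun w =>
    ENNReal.ofReal (‖fderiv ℝ u w 1‖ ^ 2 + ‖fderiv ℝ u w Complex.I‖ ^ 2) with hg
  have hgc : Continuous g := by
    have h1 := continuous_fderiv_apply_of_contDiff_two hu
    exact ENNReal.continuous_ofReal.comp (((h1 1).norm.pow 2).add ((h1 Complex.I).norm.pow 2))
  have hcirc : ∀ r θ : ℝ, ζ + Complex.polarCoord.symm (r, θ) = circleMap ζ r θ := by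
    intro r θ
    rw [Complex.polarCoord_symm_apply, circleMap, Complex.exp_mul_I]
    push_cast; rfl
  have hpolar : ∫⁻ w, g w = ∫⁻ r in Set.Ioi (0 : ℝ), ∫⁻ θ in Set.Ioo (-Real.pi) Real.pi,
      ENNReal.ofReal r * g (circleMap ζ r θ) := by
    rw [← lintegral_add_left_eq_self g ζ, ← Complex.lintegral_comp_polarCoord_symm,
      show polarCoord.target = Set.Ioi (0 : ℝ) ×ˢ Set.Ioo (-Real.pi) Real.pi from rfl,
      Measure.volume_eq_prod, ← Measure.prod_restrict, lintegral_prod]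
    · simp only [hcirc, smul_eq_mul]
    · refine Measurable.aemeasurable ?_
      have h2 : Continuous fun p : ℝ × ℝ => circleMap ζ p.1 p.2 := by
        unfold circleMap; fun_prop
      have h3 : (fun p : ℝ × ℝ => ENNReal.ofReal p.1 • g (ζ + Complex.polarCoord.symm p)) =
          fun p => ENNReal.ofReal p.1 * g (circleMap ζ p.1 p.2) := by
        ext p; rw [hcirc p.1 p.2, smul_eq_mul]
      rw [h3]
      exact (measurable_fst.ennreal_ofReal).mul (hgc.comp h2).measurable
  have hlow : ∀ r ∈ Set.Ioo ρ₁ ρ₂, ENNReal.ofReal (ε ^ 2 / (2 * Real.pi) * r⁻¹) ≤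
      ∫⁻ θ in Set.Ioo (-Real.pi) Real.pi, ENNReal.ofReal r * g (circleMap ζ r θ) := by
    intro r hr
    have hr0 : 0 < r := hρ₁.trans hr.1
    obtain ⟨a, ha, b, hb, hab⟩ := hcon r hr
    have h1 := enorm_sub_sq_le_lintegral_circle hu hr0 ha hb
    have h2 : ENNReal.ofReal (ε ^ 2) ≤ ‖u a - u b‖ₑ ^ 2 := by
      rw [← ofReal_norm, ← ENNReal.ofReal_pow (norm_nonneg _)]
      exact ENNReal.ofReal_le_ofReal (by gcongr)
    have hpi := Real.pi_pos
    rw [lintegral_const_mul' _ _ ENNReal.ofReal_ne_top]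
    calc ENNReal.ofReal (ε ^ 2 / (2 * Real.pi) * r⁻¹)
        = ENNReal.ofReal (1 / (2 * Real.pi * r)) * ENNReal.ofReal (ε ^ 2) := by
          rw [← ENNReal.ofReal_mul (by positivity)]; congr 1; field_simp
      _ ≤ ENNReal.ofReal (1 / (2 * Real.pi * r)) * (ENNReal.ofReal (2 * Real.pi * r ^ 2) *
          ∫⁻ θ in Set.Ioo (-Real.pi) Real.pi, g (circleMap ζ r θ)) := by
          gcongr; exact h2.trans h1
      _ = _ := by
          rw [← mul_assoc, ← ENNReal.ofReal_mul (by positivity)]; congr 2; field_simp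
  have hI : ∫⁻ r in Set.Ioo ρ₁ ρ₂, ENNReal.ofReal (ε ^ 2 / (2 * Real.pi) * r⁻¹) =
      ENNReal.ofReal (ε ^ 2 / (2 * Real.pi) * Real.log (ρ₂ / ρ₁)) := by
    have hci : IntegrableOn (fun r : ℝ => ε ^ 2 / (2 * Real.pi) * r⁻¹) (Set.Ioc ρ₁ ρ₂) := by
      have : IntervalIntegrable (fun r : ℝ => ε ^ 2 / (2 * Real.pi) * r⁻¹) volume ρ₁ ρ₂ := by
        refine ContinuousOn.intervalIntegrable ?_
        rw [Set.uIcc_of_le hρ.le]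
        exact continuousOn_const.mul (continuousOn_inv₀.mono fun x hx =>
          (hρ₁.trans_le hx.1).ne')
      exact (intervalIntegrable_iff_integrableOn_Ioc_of_le hρ.le).1 this
    rw [← ofReal_integral_eq_lintegral_ofReal (hci.mono_set Set.Ioo_subset_Ioc_self)]
    · rw [← integral_Ioc_eq_integral_Ioo, ← intervalIntegral.integral_of_le hρ.le,
        intervalIntegral.integral_const_mul, integral_inv_of_pos hρ₁ (hρ₁.trans hρ)]
    · refine (ae_restrict_iff' measurableSet_Ioo).2 (Eventually.of_forall fun r hr => ?_)
      have := hρ₁.trans hr.1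
      have := Real.pi_pos
      simp only [Pi.zero_apply]
      positivity
  have hfin : ENNReal.ofReal (ε ^ 2 / (2 * Real.pi) * Real.log (ρ₂ / ρ₁)) ≤ ENNReal.ofReal E := by
    rw [← hI]
    calc _ ≤ ∫⁻ r in Set.Ioo ρ₁ ρ₂, ∫⁻ θ in Set.Ioo (-Real.pi) Real.pi,
          ENNReal.ofReal r * g (circleMap ζ r θ) := setLIntegral_mono' measurableSet_Ioo hlow
      _ ≤ _ := lintegral_mono_set fun r hr => hρ₁.trans hr.1
      _ = ∫⁻ w, g w := hpolar.symm
      _ ≤ _ := hE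
  have hlogpos : 0 < Real.log (ρ₂ / ρ₁) := Real.log_pos ((one_lt_div hρ₁).2 hρ)
  have hpi := Real.pi_pos
  rcases le_or_gt E 0 with hE0 | hE0
  · rw [ENNReal.ofReal_eq_zero.2 hE0, nonpos_iff_eq_zero, ENNReal.ofReal_eq_zero] at hfin
    have : 0 < ε ^ 2 / (2 * Real.pi) * Real.log (ρ₂ / ρ₁) := by positivity
    linarith
  · rw [ENNReal.ofReal_le_ofReal_iff hE0.le, div_mul_eq_mul_div, div_le_iff₀ (by positivity)] at hfin
    linarith

/-- A function with `∂̄`-derivative conjugate-holomorphic splits into an antiholomorphic and a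
holomorphic part on a disk. -/
theorem exists_decomposition_of_dbar_eq_conj {u f : ℂ → ℂ} {a : ℂ} {R : ℝ}
    (hu : ∀ w ∈ Metric.ball a R, DifferentiableAt ℝ u w)
    (hf : DifferentiableOn ℂ f (Metric.ball a R))
    (hd : ∀ w ∈ Metric.ball a R, dbar u w = (starRingEnd ℂ) (f w)) :
    ∃ H A : ℂ → ℂ, (∀ w ∈ Metric.ball a R, HasDerivAt H (f w) w) ∧
      DifferentiableOn ℂ A (Metric.ball a R) ∧ ∀ w, u w = (starRingEnd ℂ) (H w) / 2 + A w := by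
  obtain ⟨H, hH⟩ := hf.isExactOn_ball
  refine ⟨H, fun w => u w - (starRingEnd ℂ) (H w) / 2, hH, fun w hw => ?_, fun w => by ring⟩
  refine DifferentiableAt.differentiableWithinAt ?_
  have h1 : HasFDerivAt (fun z => (starRingEnd ℂ) (H z)) _ w :=
    Complex.conjCLE.hasFDerivAt.comp w ((hH w hw).hasFDerivAt.restrictScalars ℝ)
  have h2 := (hu w hw).hasFDerivAt.sub (h1.mul_const (2 : ℂ)⁻¹)
  have h3 := hd w hw
  rw [dbar] at h3
  refine differentiableAt_complex_iff_differentiableAt_real.2 ⟨?_, ?_⟩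
  · simp only [div_eq_mul_inv]
    exact h2.differentiableAt
  · have h4 := h2.fderiv
    simp only [div_eq_mul_inv]
    have h5 : fderiv ℝ (fun w => u w - (starRingEnd ℂ) (H w) * 2⁻¹) w = _ := h4
    rw [h5]
    simp
    linear_combination (-Complex.I) * h3 + fderiv ℝ u w Complex.I * Complex.I_mul_I

theorem norm_le_of_forall_decomposition {u : ℂ → ℂ} {Kc : Set ℂ} (hK : IsCompact Kc)
    (hu : Continuous u) {B : ℝ} (hB0 : 0 ≤ B)
    (h : ∀ z ∈ Kc, ‖u z‖ ≤ B ∨ ∃ r > 0, Metric.ball z r ⊆ Kc ∧ ∃ H A : ℂ → ℂ,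
      DifferentiableOn ℂ H (Metric.ball z r) ∧ DifferentiableOn ℂ A (Metric.ball z r) ∧
      ∀ w, u w = (starRingEnd ℂ) (H w) / 2 + A w) :
    ∀ z ∈ Kc, ‖u z‖ ≤ B := by
  by_contra! hcon
  obtain ⟨z₁, hz₁, hz₁B⟩ := hcon
  obtain ⟨z₂, hz₂, hmax⟩ := hK.exists_isMaxOn ⟨z₁, hz₁⟩ hu.norm.continuousOn
  have hm : ‖u z₁‖ ≤ ‖u z₂‖ := hmax hz₁
  set m := ‖u z₂‖
  have hB : m ≠ 0 := by linarith
  set c : ℂ := (starRingEnd ℂ) (u z₂) / m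
  have hcn : ‖c‖ = 1 := by
    simp only [c, norm_div, RCLike.norm_conj, Complex.norm_real, norm_norm, m]
    exact div_self hB
  have hre : ∀ z ∈ Kc, (c * u z).re ≤ m := fun z hz =>
    (Complex.re_le_norm _).trans (by rw [norm_mul, hcn, one_mul]; exact hmax hz)
  have hz₂m : (c * u z₂).re = m := by
    have : c * u z₂ = (m : ℂ) := by
      simp only [c]
      rw [div_mul_eq_mul_div, mul_comm, Complex.mul_conj, Complex.normSq_eq_norm_sq]
      push_cast
      rw [div_eq_iff (by exact_mod_cast hB)]
      ring
    rw [this, Complex.ofReal_re]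
  let S : Set ℂ := Kc ∩ {z | (c * u z).re = m}
  have hSc : IsCompact S := hK.inter_right
    (isClosed_eq (Complex.continuous_re.comp (continuous_const.mul hu)) continuous_const)
  have hSo : IsOpen S := by
    rw [Metric.isOpen_iff]
    rintro z ⟨hz, hzm⟩
    have hzm' : (c * u z).re = m := hzm
    have hnz : B < ‖u z‖ := by
      have := (Complex.re_le_norm (c * u z))
      rw [norm_mul, hcn, one_mul] at this
      linarith
    obtain h' | ⟨r, hr, hrK, H, A, hH, hA, hHA⟩ := h z hz
    · linarith
    refine ⟨r, hr, fun w hw => ⟨hrK hw, ?_⟩⟩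
    let Φ : ℂ → ℂ := fun w => Complex.exp ((starRingEnd ℂ) c * H w / 2 + c * A w)
    have hΦn : ∀ w, ‖Φ w‖ = Real.exp (c * u w).re := by
      intro w
      simp only [Φ, Complex.norm_exp]
      congr 1
      rw [hHA w]
      simp [Complex.mul_re]
      ring
    have hΦd : DifferentiableOn ℂ Φ (Metric.ball z r) := by
      have := ((hH.const_mul ((starRingEnd ℂ) c)).div_const 2).add (hA.const_mul c)
      exact this.cexp
    have := Complex.norm_eqOn_of_isPreconnected_of_isMaxOn (convex_ball z r).isPreconnected
      Metric.isOpen_ball hΦd (Metric.mem_ball_self hr) (fun y hy => by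
        change ‖Φ y‖ ≤ ‖Φ z‖
        rw [hΦn, hΦn, Real.exp_le_exp, hzm']
        exact hre y (hrK hy)) hw
    change ‖Φ w‖ = ‖Φ z‖ at this
    rw [hΦn, hΦn, Real.exp_eq_exp, hzm'] at this
    exact this
  have huniv : S = Set.univ :=
    IsClopen.eq_univ ⟨hSc.isClosed, hSo⟩ ⟨z₂, hz₂, hz₂m⟩
  exact noncompact_univ ℂ (huniv ▸ hSc)

theorem norm_le_of_decomposition {u f H A : ℂ → ℂ} {a : ℂ} {R s ε : ℝ} (hs : 0 < s) (hsR : s < R)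
    (hH : ∀ w ∈ Metric.ball a R, HasDerivAt H (f w) w) (hA : DifferentiableOn ℂ A (Metric.ball a R))
    (hHA : ∀ w, u w = (starRingEnd ℂ) (H w) / 2 + A w)
    (hε : ∀ w ∈ Metric.sphere a s, ‖u w‖ ≤ ε) : ‖f a‖ ≤ 2 * ε / s := by
  have hcb : Metric.closedBall a s ⊆ Metric.ball a R := Metric.closedBall_subset_ball hsR
  have hHd : DifferentiableOn ℂ H (Metric.ball a R) := fun w hw =>
    (hH w hw).differentiableAt.differentiableWithinAt
  have hsp : Metric.sphere a s ⊆ Metric.ball a R := Metric.sphere_subset_closedBall.trans hcb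
  have h1 := Complex.two_pi_I_inv_smul_circleIntegral_sub_sq_inv_smul_of_differentiable
    Metric.isOpen_ball hcb hHd (Metric.mem_ball_self hs)
  rw [(hH a (Metric.mem_ball_self (hs.trans hsR))).deriv] at h1
  have h2 : ∮ z in C(a, s), A z = 0 :=
    Complex.circleIntegral_eq_zero_of_differentiable_on_off_countable hs.le Set.countable_empty
      (hA.continuousOn.mono hcb) fun z hz =>
        (hA z (hcb (Metric.ball_subset_closedBall hz.1))).differentiableAt
          (Metric.isOpen_ball.mem_nhds (hcb (Metric.ball_subset_closedBall hz.1)))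
  have hAi : CircleIntegrable A a s := (hA.continuousOn.mono hsp).circleIntegrable hs.le
  have hCi : CircleIntegrable (fun z => (starRingEnd ℂ) (H z) / 2) a s :=
    ContinuousOn.circleIntegrable hs.le
      (((Complex.continuous_conj.comp_continuousOn hHd.continuousOn).mono hsp).div_const 2)
  have h3 : ∮ z in C(a, s), u z = ∮ z in C(a, s), (starRingEnd ℂ) (H z) / 2 := by
    simp_rw [hHA]
    rw [circleIntegral.integral_add hCi hAi, h2, add_zero]
  have h4 : (starRingEnd ℂ) (∮ z in C(a, s), (starRingEnd ℂ) (H z) / 2) =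
      - (s ^ 2 / 2 : ℂ) * ∮ z in C(a, s), ((z - a) ^ 2)⁻¹ • H z := by
    simp only [circleIntegral, intervalIntegral.integral_of_le Real.two_pi_pos.le]
    rw [← integral_conj, ← integral_const_mul]
    refine integral_congr_ae (Eventually.of_forall fun θ => ?_)
    have hw : circleMap 0 s θ * (starRingEnd ℂ) (circleMap 0 s θ) = (s : ℂ) ^ 2 := by
      rw [Complex.mul_conj, Complex.normSq_eq_norm_sq]
      simp
    have hw0 : circleMap 0 s θ ≠ 0 := circleMap_ne_center hs.ne'
    simp only [deriv_circleMap, smul_eq_mul, map_mul, Complex.conj_I, map_div₀, Complex.conj_conj,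
      circleMap_sub_center, map_ofNat]
    field_simp
    linear_combination (-1) * H (circleMap a s θ) * hw
  have h5 : ‖∮ z in C(a, s), u z‖ ≤ 2 * Real.pi * s * ε :=
    circleIntegral.norm_integral_le_of_norm_le_const hs.le hε
  have h6 : ‖∮ z in C(a, s), u z‖ = s ^ 2 / 2 * (2 * Real.pi * ‖f a‖) := by
    have h7 : ∮ z in C(a, s), ((z - a) ^ 2)⁻¹ • H z = (2 * Real.pi * Complex.I : ℂ) * f a := by
      rw [← h1, smul_eq_mul, mul_inv_cancel_left₀]
      simp [Real.pi_ne_zero]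
    rw [h3, ← RCLike.norm_conj, h4, h7]
    simp [abs_of_pos Real.pi_pos]
  rw [h6] at h5
  rw [le_div_iff₀ hs]
  have hpi := Real.pi_pos
  have : (‖f a‖ * s) * (Real.pi * s) ≤ (2 * ε) * (Real.pi * s) := by linarith
  exact le_of_mul_le_mul_right this (by positivity)

theorem integral_mul_inv_sub_eq_zero_of_lt_norm {h : ℂ → ℂ} {M : ℝ} (hh : Integrable h)
    (hM : ∀ x, h x ≠ 0 → ‖x‖ ≤ M) (hn : ∀ n : ℕ, ∫ x, h x * x ^ n = 0) {w : ℂ} (hM0 : 0 ≤ M)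
    (hw : M < ‖w‖) : ∫ x, h x * (w - x)⁻¹ = 0 := by
  have hw0 : w ≠ 0 := norm_pos_iff.1 (hM0.trans_lt hw)
  have hq : M / ‖w‖ < 1 := (div_lt_one (hM0.trans_lt hw)).2 hw
  have hq0 : 0 ≤ M / ‖w‖ := by positivity
  have hs := hasSum_integral_of_dominated_convergence (μ := volume)
    (F := fun (n : ℕ) x => h x * x ^ n * (w⁻¹) ^ (n + 1)) (f := fun x => h x * (w - x)⁻¹)
    (fun n x => ‖h x‖ * (‖w‖⁻¹ * (M / ‖w‖) ^ n)) ?_ ?_ ?_ ?_ ?_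
  · have h0 : ∀ n : ℕ, ∫ x, h x * x ^ n * (w⁻¹) ^ (n + 1) = 0 := fun n => by
      rw [integral_mul_const, hn, zero_mul]
    simp only [h0] at hs
    exact hs.unique hasSum_zero
  · intro n
    exact (hh.aestronglyMeasurable.mul (continuous_pow n).aestronglyMeasurable).mul_const _
  · intro n
    refine Eventually.of_forall fun x => ?_
    by_cases hx : h x = 0
    · simp [hx]
    · rw [norm_mul, norm_mul, norm_pow, norm_pow, norm_inv, mul_assoc]
      have hx' := hM x hx
      have h1 : ‖w‖⁻¹ * (M / ‖w‖) ^ n = M ^ n * ‖w‖⁻¹ ^ (n + 1) := by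
        rw [div_eq_mul_inv, mul_pow, pow_succ]; ring
      rw [h1]
      gcongr
  · exact Eventually.of_forall fun x =>
      ((summable_geometric_of_lt_one hq0 hq).mul_left _).mul_left _
  · simp only [tsum_mul_left]
    exact hh.norm.mul_const _
  · refine Eventually.of_forall fun x => ?_
    by_cases hx : h x = 0
    · simp only [hx, zero_mul]; exact hasSum_zero
    · have hx' := hM x hx
      have hxw : ‖x * w⁻¹‖ < 1 := by
        rw [norm_mul, norm_inv, ← div_eq_mul_inv]
        exact (div_lt_one (hM0.trans_lt hw)).2 (hx'.trans_lt hw)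
      have := ((hasSum_geometric_of_norm_lt_one hxw).mul_left w⁻¹).mul_left (h x)
      have hne : w - x ≠ 0 := by
        intro h0
        rw [sub_eq_zero] at h0
        rw [h0] at hw; linarith
      have e1 : (fun n : ℕ => h x * (w⁻¹ * (x * w⁻¹) ^ n)) =
          fun n : ℕ => h x * x ^ n * w⁻¹ ^ (n + 1) := by
        ext n; rw [mul_pow, pow_succ]; ring
      have e2 : h x * (w⁻¹ * (1 - x * w⁻¹)⁻¹) = h x * (w - x)⁻¹ := by
        have h1 : 1 - x * w⁻¹ = (w - x) * w⁻¹ := by field_simp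
        rw [h1, mul_inv, inv_inv]; field_simp
      rw [e1, e2] at this
      exact this

theorem integral_mul_inv_sub_eq_zero {h : ℂ → ℂ} {M : ℝ} (hh : Integrable h)
    (hM : ∀ x, h x ≠ 0 → ‖x‖ ≤ M) (hn : ∀ n : ℕ, ∫ x, h x * x ^ n = 0) {C Ω : Set ℂ}
    (hC : IsClosed C) (hsupp : ∀ x, h x ≠ 0 → x ∈ C) (hΩ : IsOpen Ω) (hΩc : IsPreconnected Ω)
    (hdisj : Disjoint Ω C) (hfar : ∃ M : ℝ, ∀ z : ℂ, M < ‖z‖ → z ∈ Ω) :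
    ∀ w ∈ Ω, ∫ x, h x * (w - x)⁻¹ = 0 := by
  obtain ⟨M', hM'⟩ := hfar
  set F : ℂ → ℂ := fun w => ∫ x, h x * (w - x)⁻¹ with hF
  have hd : DifferentiableOn ℂ F Ω := by
    intro w hw
    have hwC : w ∈ Cᶜ := fun h => Set.disjoint_left.1 hdisj hw h
    obtain ⟨r, hr, hrC⟩ := Metric.isOpen_iff.1 hC.isOpen_compl w hwC
    have hδ : 0 < r / 3 := by positivity
    have hfar : ∀ y ∈ Metric.ball w (r / 3), ∀ x, h x ≠ 0 → r / 3 < ‖y - x‖ := by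
      intro y hy x hx
      by_contra hcon
      have h1 : ‖y - w‖ < r / 3 := by simpa [dist_eq_norm] using hy
      have h2 : x ∈ Metric.ball w r := by
        rw [Metric.mem_ball, dist_eq_norm]
        calc ‖x - w‖ = ‖(y - w) - (y - x)‖ := by ring_nf
          _ ≤ ‖y - w‖ + ‖y - x‖ := norm_sub_le _ _
          _ < r := by linarith [not_lt.1 hcon]
      exact hrC h2 (hsupp x hx)
    have he : F =ᶠ[nhds w] smoothCauchyTransform (r / 3) h := by
      filter_upwards [Metric.ball_mem_nhds w hδ] with y hy
      exact (smoothCauchyTransform_eq hδ fun x hx => (hfar y hy x hx).le).symm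
    have hdb : dbar (smoothCauchyTransform (r / 3) h) w = 0 := by
      rw [dbar_smoothCauchyTransform hδ hh hM]
      refine integral_eq_zero_of_ae (Eventually.of_forall fun x => ?_)
      by_cases hx : h x = 0
      · simp [hx]
      · simp [radialBump_eq_zero hδ (hfar w (Metric.mem_ball_self hδ) x hx)]
    refine DifferentiableAt.differentiableWithinAt ?_
    refine DifferentiableAt.congr_of_eventuallyEq ?_ he
    refine differentiableAt_complex_iff_differentiableAt_real.2
      ⟨((contDiff_smoothCauchyTransform hδ hh hM).differentiable (by simp)).differentiableAt, ?_⟩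
    rw [dbar] at hdb
    rw [smul_eq_mul]
    linear_combination (-Complex.I) * hdb +
      fderiv ℝ (smoothCauchyTransform (r / 3) h) w Complex.I * Complex.I_mul_I
  set N := max (max M M') 0
  obtain ⟨w₀, hw₀⟩ : ∃ w₀ : ℂ, N < ‖w₀‖ := by
    refine ⟨((N + 1 : ℝ) : ℂ), ?_⟩
    rw [Complex.norm_real, Real.norm_eq_abs]
    exact (lt_add_one _).trans_le (le_abs_self _)
  have hev : F =ᶠ[nhds w₀] 0 := by
    filter_upwards [continuous_norm.continuousAt.eventually (lt_mem_nhds hw₀)] with y hy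
    refine integral_mul_inv_sub_eq_zero_of_lt_norm (M := max M 0) hh
      (fun x hx => (hM x hx).trans (le_max_left _ _)) hn (le_max_right _ _) ?_
    refine lt_of_le_of_lt ?_ hy
    exact max_le ((le_max_left _ _).trans (le_max_left _ _)) (le_max_right _ _)
  have hw₀Ω : w₀ ∈ Ω := hM' _ (((le_max_right _ _).trans (le_max_left _ _)).trans_lt hw₀)
  exact fun w hw => (hd.analyticOnNhd hΩ).eqOn_zero_of_preconnected_of_eventuallyEq_zero hΩc
    hw₀Ω hev hw

theorem hasCompactSupport_smoothCauchyTransform {δ M : ℝ} {h : ℂ → ℂ} (hδ : 0 < δ)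
    (hh : Integrable h) (hM : ∀ x, h x ≠ 0 → ‖x‖ ≤ M) (hn : ∀ n : ℕ, ∫ x, h x * x ^ n = 0) :
    HasCompactSupport (smoothCauchyTransform δ h) := by
  refine HasCompactSupport.intro (isCompact_closedBall (0 : ℂ) (max M 0 + δ)) fun w hw => ?_
  rw [mem_closedBall_zero_iff, not_le] at hw
  rw [smoothCauchyTransform_eq hδ fun x hx => ?_]
  · exact integral_mul_inv_sub_eq_zero_of_lt_norm (M := max M 0) hh
      (fun x hx => (hM x hx).trans (le_max_left _ _)) hn (le_max_right _ _) (by linarith)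
  · have h1 := (hM x hx).trans (le_max_left M 0)
    have h2 := norm_sub_norm_le w x
    linarith

theorem lintegral_normSq_fderiv_smoothCauchyTransform_le {δ M : ℝ} {h : ℂ → ℂ} (hδ : 0 < δ)
    (hh : Integrable h) (hM : ∀ x, h x ≠ 0 → ‖x‖ ≤ M) (hn : ∀ n : ℕ, ∫ x, h x * x ^ n = 0) :
    ∫⁻ w, ENNReal.ofReal (‖fderiv ℝ (smoothCauchyTransform δ h) w 1‖ ^ 2 +
      ‖fderiv ℝ (smoothCauchyTransform δ h) w Complex.I‖ ^ 2) ≤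
      ENNReal.ofReal (2 * Real.pi) ^ 2 * ∫⁻ x, ‖h x‖ₑ ^ 2 := by
  have hu := contDiff_smoothCauchyTransform hδ hh hM
  have hc := hasCompactSupport_smoothCauchyTransform hδ hh hM hn
  have hi : Integrable fun w => ‖fderiv ℝ (smoothCauchyTransform δ h) w 1‖ ^ 2 +
      ‖fderiv ℝ (smoothCauchyTransform δ h) w Complex.I‖ ^ 2 :=
    (integrable_norm_sq_fderiv hu hc 1).add (integrable_norm_sq_fderiv hu hc Complex.I)
  have hi2 : Integrable fun w => ‖dbar (smoothCauchyTransform δ h) w‖ ^ 2 := by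
    refine Continuous.integrable_of_hasCompactSupport ?_ ?_
    · exact ((continuous_fderiv_apply_of_contDiff_two hu 1).add
        (continuous_const.mul (continuous_fderiv_apply_of_contDiff_two hu Complex.I))).norm.pow 2
    · refine HasCompactSupport.mono' (hc.fderiv ℝ) fun w hw => subset_tsupport _ ?_
      rw [Function.mem_support] at hw ⊢
      intro h0
      simp [dbar, h0] at hw
  rw [← ofReal_integral_eq_lintegral_ofReal hi (Eventually.of_forall fun w => by
    simp only [Pi.zero_apply]; positivity)]
  rw [integral_normSq_fderiv_eq hu hc, ofReal_integral_eq_lintegral_ofReal hi2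
    (Eventually.of_forall fun w => by simp only [Pi.zero_apply]; positivity)]
  refine le_trans (le_of_eq ?_)
    (lintegral_norm_sq_integral_radialBump_le hδ hh.aestronglyMeasurable)
  refine lintegral_congr fun w => ?_
  rw [← dbar_smoothCauchyTransform hδ hh hM, ENNReal.ofReal_pow (norm_nonneg _), ofReal_norm]

theorem dbar_smoothCauchyTransform_indicator_conj {G : Set ℂ} {f : ℂ → ℂ} {δ R M : ℝ} {w : ℂ}
    (hG : MeasurableSet G) (hδ : 0 < δ)
    (hh : Integrable (G.indicator fun x => (starRingEnd ℂ) (f x)))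
    (hM : ∀ x, G.indicator (fun x => (starRingEnd ℂ) (f x)) x ≠ 0 → ‖x‖ ≤ M)
    (hδR : δ < R) (hR : Metric.ball w R ⊆ G) (hf : DifferentiableOn ℂ f G) :
    dbar (smoothCauchyTransform δ (G.indicator fun x => (starRingEnd ℂ) (f x))) w =
      (starRingEnd ℂ) (2 * Real.pi * f w) := by
  have hout : ∀ x, x ∉ Metric.ball w R → radialBump δ ‖w - x‖ = 0 := fun x hx => by
    refine radialBump_eq_zero hδ (hδR.trans_le ?_)
    rwa [Metric.mem_ball, not_lt, dist_comm, dist_eq_norm] at hx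
  have hfi : IntegrableOn f G := by
    rw [integrable_indicator_iff hG] at hh
    have := (Complex.conjCLE.toContinuousLinearMap.integrable_comp hh)
    simpa [IntegrableOn] using this
  have hkcont : Continuous fun z : ℂ => (radialBump δ ‖z - w‖ : ℂ) :=
    Complex.continuous_ofReal.comp ((continuous_radialBump δ).comp (by fun_prop))
  obtain ⟨B, hB⟩ : ∃ B, ∀ z : ℂ, ‖(radialBump δ ‖z - w‖ : ℂ)‖ ≤ B := by
    have hcs : HasCompactSupport fun z : ℂ => (radialBump δ ‖z - w‖ : ℂ) := by
      refine HasCompactSupport.intro (isCompact_closedBall w R) fun x hx => ?_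
      rw [norm_sub_rev, hout x fun h => hx (Metric.ball_subset_closedBall h)]; simp
    exact hcs.exists_bound_of_continuous hkcont
  have hk : IntegrableOn (fun z : ℂ => (radialBump δ ‖z - w‖ : ℂ)) (Metric.ball w R) :=
    (hkcont.locallyIntegrable.integrableOn_isCompact (isCompact_closedBall w R)).mono_set
      Metric.ball_subset_closedBall
  have hkf : IntegrableOn (fun z : ℂ => (radialBump δ ‖z - w‖ : ℂ) * f z) (Metric.ball w R) :=
    (hfi.mono_set hR).bdd_mul hkcont.aestronglyMeasurable (Eventually.of_forall hB)
  have hmv := setIntegral_radial_mul (radialBump δ) (hf.mono hR) hk hkf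
  have hk1 : ∫ z in Metric.ball w R, (radialBump δ ‖z - w‖ : ℂ) = 2 * Real.pi := by
    rw [setIntegral_eq_integral_of_forall_compl_eq_zero fun x hx => by
      rw [norm_sub_rev, hout x hx]; simp]
    rw [integral_sub_right_eq_self (fun z : ℂ => (radialBump δ ‖z‖ : ℂ)) w, integral_complex_ofReal,
      integral_radialBump hδ]
    push_cast; rfl
  rw [dbar_smoothCauchyTransform hδ hh hM, ← setIntegral_eq_integral_of_forall_compl_eq_zero
    (s := Metric.ball w R) fun x hx => by rw [hout x hx]; simp]
  rw [hk1] at hmv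
  rw [mul_comm, ← hmv, ← integral_conj]
  refine setIntegral_congr_fun Metric.isOpen_ball.measurableSet fun x hx => ?_
  simp only [Set.indicator_of_mem (hR hx), map_mul, Complex.conj_ofReal]
  rw [norm_sub_rev, mul_comm]

theorem exists_isCompact_inter_sphere_nonempty {Ω : Set ℂ} (hΩ : IsOpen Ω) (hc : IsConnected Ω)
    (hfar : ∃ M : ℝ, ∀ z : ℂ, M < ‖z‖ → z ∈ Ω) {ζ : ℂ} (hζ : ζ ∈ closure Ω) {ρ₁ : ℝ} (hρ₁ : 0 < ρ₁)
    (ρ₂ : ℝ) : ∃ T ⊆ Ω, IsCompact T ∧ ∀ r ∈ Set.Ioo ρ₁ ρ₂, (Metric.sphere ζ r ∩ T).Nonempty := by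
  obtain ⟨M, hM⟩ := hfar
  obtain ⟨p, hpΩ, hp⟩ := Metric.mem_closure_iff.1 hζ ρ₁ hρ₁
  obtain ⟨q, hq⟩ : ∃ q : ℂ, max M (ρ₂ + ‖ζ‖) < ‖q‖ := by
    refine ⟨((max M (ρ₂ + ‖ζ‖) + 1 : ℝ) : ℂ), ?_⟩
    rw [Complex.norm_real, Real.norm_eq_abs]
    exact (lt_add_one _).trans_le (le_abs_self _)
  have hqΩ : q ∈ Ω := hM q ((le_max_left _ _).trans_lt hq)
  obtain ⟨γ, hγ⟩ := (hΩ.isConnected_iff_isPathConnected.1 hc).joinedIn p hpΩ q hqΩ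
  refine ⟨Set.range γ, Set.range_subset_iff.2 hγ, isCompact_range γ.continuous, fun r hr => ?_⟩
  have hcont : Continuous fun t => dist (γ t) ζ := γ.continuous.dist continuous_const
  have hsub := intermediate_value_univ (0 : unitInterval) 1 hcont
  obtain ⟨t, ht⟩ := hsub (show r ∈ Set.Icc _ _ by
    constructor
    · rw [γ.source, dist_comm]; exact (hp.trans hr.1).le
    · rw [γ.target, dist_eq_norm]
      have h1 := norm_sub_norm_le q ζ
      have h2 := (le_max_right _ _).trans_lt hq
      linarith [hr.2])
  exact ⟨γ t, ht, t, rfl⟩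

theorem eq_zero_of_forall_setIntegral_conj_mul_pow_eq_zero {G : Set ℂ} {f : ℂ → ℂ}
    (hG : IsOpen G) (hb : Bornology.IsBounded G)
    (hJ : ∃ γ : C(Metric.sphere (0 : ℂ) 1, ℂ), Function.Injective γ ∧ Set.range γ = frontier G)
    (hf : DifferentiableOn ℂ f G) (hf2 : MemLp f 2 (volume.restrict G))
    (hn : ∀ n : ℕ, ∫ x in G, (starRingEnd ℂ) (f x) * x ^ n = 0) : ∀ a ∈ G, f a = 0 := by
  intro a ha
  set h : ℂ → ℂ := G.indicator fun x => (starRingEnd ℂ) (f x) with hhdef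
  have hGm := hG.measurableSet
  have : IsFiniteMeasure (volume.restrict G) :=
    ⟨by rw [Measure.restrict_apply_univ]; exact hb.measure_lt_top⟩
  have hh : Integrable h := by
    rw [hhdef, integrable_indicator_iff hGm]
    exact Complex.conjCLE.toContinuousLinearMap.integrable_comp (hf2.integrable (by norm_num))
  have hhG : ∀ x, h x ≠ 0 → x ∈ G := fun x hx => Set.mem_of_indicator_ne_zero hx
  obtain ⟨M, hM'⟩ := hb.exists_norm_le
  have hM : ∀ x, h x ≠ 0 → ‖x‖ ≤ M := fun x hx => hM' x (hhG x hx)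
  have hhn : ∀ n : ℕ, ∫ x, h x * x ^ n = 0 := fun n => by
    rw [← hn n, ← integral_indicator hGm]
    congr 1; ext x
    by_cases hx : x ∈ G <;> simp [hhdef, hx]
  obtain ⟨Ω, hΩ, hΩc, hΩG, hfar, hfr⟩ := exists_exterior_domain hG ⟨a, ha⟩ hb hJ
  obtain ⟨E, hE0, hE⟩ : ∃ E : ℝ, 0 ≤ E ∧
      ENNReal.ofReal (2 * Real.pi) ^ 2 * ∫⁻ x, ‖h x‖ₑ ^ 2 ≤ ENNReal.ofReal E := by
    have hfin : ENNReal.ofReal (2 * Real.pi) ^ 2 * ∫⁻ x, ‖h x‖ₑ ^ 2 ≠ ⊤ := by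
      refine ENNReal.mul_ne_top (ENNReal.pow_ne_top ENNReal.ofReal_ne_top) ?_
      have h1 := hf2.eLpNorm_lt_top
      rw [eLpNorm_lt_top_iff_lintegral_rpow_enorm_lt_top (by norm_num) (by norm_num)] at h1
      have h2 : ∫⁻ x, ‖h x‖ₑ ^ 2 = ∫⁻ x in G, ‖f x‖ₑ ^ 2 := by
        rw [← lintegral_indicator hGm]
        congr 1; ext x
        by_cases hx : x ∈ G <;> simp [hhdef, hx]
      rw [h2]
      simpa using h1.ne
    exact ⟨_, ENNReal.toReal_nonneg, (ENNReal.ofReal_toReal hfin).ge⟩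
  obtain ⟨R, hR, hRG⟩ := Metric.isOpen_iff.1 hG a ha
  set s := R / 3 with hs
  have hs0 : 0 < s := by positivity
  have hfra : ∀ ζ ∈ frontier G, 3 * s ≤ dist ζ a := fun ζ hζ => by
    by_contra hcon
    refine (hG.frontier_eq ▸ hζ).2 (hRG ?_)
    rw [Metric.mem_ball]; linarith [not_le.1 hcon]
  have key : ∀ ε > 0, ‖2 * Real.pi * f a‖ ≤ 2 * ε / s := by
    intro ε hε
    obtain ⟨ρ₁, hρ₁, hρ, hlog⟩ : ∃ ρ₁ : ℝ, 0 < ρ₁ ∧ ρ₁ < s ∧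
        2 * Real.pi * E < ε ^ 2 * Real.log (s / ρ₁) := by
      set N := 2 * Real.pi * E / ε ^ 2 + 1 with hN
      have hN0 : 0 < N := by positivity
      refine ⟨s * Real.exp (-N), by positivity, ?_, ?_⟩
      · have : Real.exp (-N) < 1 := Real.exp_lt_one_iff.mpr (by linarith)
        nlinarith
      · have h1 : s / (s * Real.exp (-N)) = Real.exp N := by
          rw [Real.exp_neg]; field_simp
        rw [h1, Real.log_exp, hN, mul_add, mul_div_cancel₀ _ (by positivity)]
        nlinarith [sq_pos_of_pos hε]
    have hclG : IsCompact (closure G) := hb.isCompact_closure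
    have hfrc : IsCompact (frontier G) := hclG.of_isClosed_subset isClosed_frontier
      frontier_subset_closure
    obtain ⟨t, ht, htc⟩ := hfrc.elim_nhds_subcover (fun ζ => Metric.ball ζ ρ₁)
      fun ζ _ => Metric.ball_mem_nhds ζ hρ₁
    choose! T hTΩ hTc hTs using fun ζ (hζ : ζ ∈ frontier G) =>
      exists_isCompact_inter_sphere_nonempty hΩ hΩc hfar (hfr hζ) hρ₁ s
    have hCT : IsCompact (⋃ ζ ∈ t, T ζ) := t.isCompact_biUnion fun ζ hζ => hTc ζ (ht ζ hζ)
    have hCTG : (⋃ ζ ∈ t, T ζ) ⊆ (closure G)ᶜ := by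
      refine Set.iUnion₂_subset fun ζ hζ x hx => ?_
      exact Set.disjoint_left.1 hΩG (hTΩ ζ (ht ζ hζ) hx)
    obtain ⟨δ₁, hδ₁, hδ₁T⟩ := hCT.exists_cthickening_subset_open isClosed_closure.isOpen_compl hCTG
    have hK0 : IsCompact (closure G \ ⋃ ζ ∈ t, Metric.ball ζ ρ₁) :=
      hclG.diff (isOpen_biUnion fun _ _ => Metric.isOpen_ball)
    have hK0G : (closure G \ ⋃ ζ ∈ t, Metric.ball ζ ρ₁) ⊆ G := by
      rintro x ⟨hx, hxt⟩
      by_contra hxG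
      exact hxt (htc (hG.frontier_eq ▸ ⟨hx, hxG⟩))
    obtain ⟨δ₂, hδ₂, hδ₂K⟩ := hK0.exists_cthickening_subset_open hG hK0G
    set δ := min δ₁ (δ₂ / 2) with hδdef
    have hδ : 0 < δ := by positivity
    have hδ1 : δ ≤ δ₁ := min_le_left _ _
    have hδ2 : δ < δ₂ := (min_le_right _ _).trans_lt (by linarith)
    set u := smoothCauchyTransform δ h with hu
    have hu2 : ContDiff ℝ 2 u := contDiff_smoothCauchyTransform hδ hh hM
    have hen := (lintegral_normSq_fderiv_smoothCauchyTransform_le hδ hh hM hhn).trans hE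
    choose r hr hosc using fun ζ => exists_circle_oscillation_le hu2 hen hρ₁ hρ hε hlog ζ
    have hu0 : ∀ ζ ∈ t, ∀ p ∈ T ζ, u p = 0 := by
      intro ζ hζ p hp
      rw [hu, smoothCauchyTransform_eq hδ fun x hx => ?_]
      · exact integral_mul_inv_sub_eq_zero hh hM hhn isClosed_closure
          (fun x hx => subset_closure (hhG x hx)) hΩ hΩc.isPreconnected hΩG hfar p
          (hTΩ ζ (ht ζ hζ) hp)
      · by_contra hcon
        refine hδ₁T (Metric.thickening_subset_cthickening _ _ (Metric.mem_thickening_iff.2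
          ⟨p, Set.mem_biUnion hζ hp, ?_⟩)) (subset_closure (hhG x hx))
        rw [dist_comm, dist_eq_norm]; linarith [not_le.1 hcon]
    have husp : ∀ ζ ∈ t, ∀ w ∈ Metric.sphere ζ (r ζ), ‖u w‖ ≤ ε := by
      intro ζ hζ w hw
      obtain ⟨p, hps, hpT⟩ := hTs ζ (ht ζ hζ) (r ζ) (hr ζ)
      have := hosc ζ w hw p hps
      rwa [hu0 ζ hζ p hpT, sub_zero] at this
    set Kc := closure G \ ⋃ ζ ∈ t, Metric.ball ζ (r ζ) with hKc
    have hKcK0 : Kc ⊆ closure G \ ⋃ ζ ∈ t, Metric.ball ζ ρ₁ :=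
      Set.sdiff_subset_sdiff_right (Set.iUnion₂_mono fun ζ _ => Metric.ball_subset_ball (hr ζ).1.le)
    have hKcc : IsCompact Kc := hclG.diff (isOpen_biUnion fun _ _ => Metric.isOpen_ball)
    have hdb : ∀ w ∈ Kc, dbar u w = (starRingEnd ℂ) (2 * Real.pi * f w) := fun w hw =>
      dbar_smoothCauchyTransform_indicator_conj hGm hδ hh hM hδ2
        ((Metric.ball_subset_closedBall.trans
          (Metric.closedBall_subset_cthickening (hKcK0 hw) δ₂)).trans hδ₂K) hf
    have hdec : ∀ z R', Metric.ball z R' ⊆ Kc → ∃ H A : ℂ → ℂ,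
        (∀ w ∈ Metric.ball z R', HasDerivAt H (2 * Real.pi * f w) w) ∧
        DifferentiableOn ℂ A (Metric.ball z R') ∧
        ∀ w, u w = (starRingEnd ℂ) (H w) / 2 + A w := fun z R' hz =>
      exists_decomposition_of_dbar_eq_conj
        (fun w _ => (hu2.differentiable (by simp)).differentiableAt)
        ((hf.mono fun w hw => hK0G (hKcK0 (hz hw))).const_mul _) fun w hw => hdb w (hz hw)
    have hmax : ∀ z ∈ Kc, ‖u z‖ ≤ ε := by
      refine norm_le_of_forall_decomposition hKcc hu2.continuous hε.le fun z hz => ?_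
      by_cases hzs : ∃ ζ ∈ t, z ∈ Metric.sphere ζ (r ζ)
      · obtain ⟨ζ, hζ, hzζ⟩ := hzs
        exact Or.inl (husp ζ hζ z hzζ)
      · push Not at hzs
        right
        have hopen : IsOpen (G \ ⋃ ζ ∈ t, Metric.closedBall ζ (r ζ)) :=
          hG.sdiff (t.finite_toSet.isClosed_biUnion fun _ _ => Metric.isClosed_closedBall)
        obtain ⟨R', hR', hR'K⟩ := Metric.isOpen_iff.1 hopen z ⟨hK0G (hKcK0 hz), fun hmem => by
          obtain ⟨ζ, hζ, hzζ⟩ := Set.mem_iUnion₂.1 hmem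
          refine hz.2 (Set.mem_biUnion hζ ?_)
          exact lt_of_le_of_ne hzζ fun he => hzs ζ hζ he⟩
        have hsub : Metric.ball z R' ⊆ Kc := hR'K.trans (Set.sdiff_subset_sdiff subset_closure
          (Set.iUnion₂_mono fun ζ _ => Metric.ball_subset_closedBall))
        obtain ⟨H, A, hH, hA, hHA⟩ := hdec z R' hsub
        exact ⟨R', hR', hsub, H, A, fun w hw =>
          (hH w hw).differentiableAt.differentiableWithinAt, hA, hHA⟩
    have hball : Metric.ball a (2 * s) ⊆ Kc := by
      intro w hw
      rw [Metric.mem_ball] at hw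
      refine ⟨subset_closure (hRG ?_), fun hmem => ?_⟩
      · rw [Metric.mem_ball]; linarith
      · obtain ⟨ζ, hζ, hwζ⟩ := Set.mem_iUnion₂.1 hmem
        rw [Metric.mem_ball] at hwζ
        have h1 := hfra ζ (ht ζ hζ)
        have h2 := dist_triangle_left ζ a w
        linarith [(hr ζ).2]
    obtain ⟨H, A, hH, hA, hHA⟩ := hdec a (2 * s) hball
    refine norm_le_of_decomposition (f := fun w => 2 * Real.pi * f w) hs0 (by linarith) hH hA hHA
      fun w hw => hmax w (hball ?_)
    rw [Metric.mem_sphere] at hw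
    rw [Metric.mem_ball]; linarith
  have h0 : ‖2 * Real.pi * f a‖ ≤ 0 := by
    refine le_of_forall_pos_le_add fun e he => ?_
    refine (key (e * s / 2) (by positivity)).trans (le_of_eq ?_)
    field_simp
    ring
  simpa [Real.pi_ne_zero] using norm_le_zero_iff.1 h0

theorem continuousAt_of_leftInvOn {G : Set ℂ} {φ ψ : ℂ → ℂ} (hG : IsOpen G)
    (hφ : DifferentiableOn ℂ φ G) (hinv : Set.LeftInvOn ψ φ G) {z : ℂ} (hz : z ∈ G) :
    nhds (φ z) ≤ map φ (nhds z) ∧ ContinuousAt ψ (φ z) := by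
  have hzG := hG.mem_nhds hz
  have hle : nhds (φ z) ≤ map φ (nhds z) := by
    refine (hφ.analyticAt hzG).eventually_constant_or_nhds_le_map_nhds.resolve_left fun hc => ?_
    have h1 : ∀ᶠ w in nhds z, w = z := by
      filter_upwards [hc, hzG] with w hw hwG
      rw [← hinv hwG, hw, hinv hz]
    have h2 : ∀ᶠ w in nhdsWithin z {z}ᶜ, w = z := h1.filter_mono nhdsWithin_le_nhds
    obtain ⟨w, hw, hw'⟩ := (h2.and self_mem_nhdsWithin).exists
    exact hw' hw
  refine ⟨hle, ?_⟩
  rw [ContinuousAt, hinv hz]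
  refine Tendsto.mono_left ?_ hle
  rw [tendsto_map'_iff]
  refine tendsto_id.congr' ?_
  filter_upwards [hzG] with w hw using (hinv hw).symm

theorem hasDerivAt_leftInvOn_of_deriv_ne_zero {G : Set ℂ} {φ ψ : ℂ → ℂ} (hG : IsOpen G)
    (hφ : DifferentiableOn ℂ φ G) (hinv : Set.LeftInvOn ψ φ G) {z : ℂ} (hz : z ∈ G)
    (h0 : deriv φ z ≠ 0) : HasDerivAt ψ (deriv φ z)⁻¹ (φ z) := by
  obtain ⟨hle, hc⟩ := continuousAt_of_leftInvOn hG hφ hinv hz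
  refine HasDerivAt.of_local_left_inverse (f := φ) hc ?_ h0 ?_
  · rw [hinv hz]; exact (hφ.differentiableAt (hG.mem_nhds hz)).hasDerivAt
  · refine hle ?_
    rw [mem_map]
    filter_upwards [hG.mem_nhds hz] with w hw
    simp only [Set.mem_preimage, Set.mem_ofPred_eq, hinv hw]

theorem deriv_ne_zero_of_leftInvOn {G : Set ℂ} {φ ψ : ℂ → ℂ} (hG : IsOpen G)
    (hφ : DifferentiableOn ℂ φ G) (hinv : Set.LeftInvOn ψ φ G) {z : ℂ} (hz : z ∈ G) :
    deriv φ z ≠ 0 := by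
  intro h0
  have hzG := hG.mem_nhds hz
  obtain ⟨hle, hc⟩ := continuousAt_of_leftInvOn hG hφ hinv hz
  have han := hφ.analyticAt hzG
  have hp : ∀ᶠ w in nhdsWithin z {z}ᶜ, deriv φ w ≠ 0 := by
    refine han.deriv.eventually_eq_zero_or_eventually_ne_zero.resolve_left fun hev => ?_
    obtain ⟨r, hr, hrG⟩ := Metric.eventually_nhds_iff_ball.1 (hev.and hzG)
    obtain ⟨w, hw, hwz⟩ : ∃ w ∈ Metric.ball z r, w ≠ z := by
      refine ⟨z + (r / 2 : ℝ), ?_, ?_⟩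
      · simp [abs_of_pos hr]; linarith
      · simp [hr.ne']
    have hconst := (convex_ball z r).is_const_of_fderivWithin_eq_zero (𝕜 := ℂ)
      (hφ.mono fun y hy => (hrG y hy).2) (fun y hy => by
        rw [fderivWithin_of_isOpen Metric.isOpen_ball hy]
        ext; simp [(hrG y hy).1]) hw (Metric.mem_ball_self hr)
    rw [← hinv (hrG w hw).2, hconst, hinv hz] at hwz
    exact hwz rfl
  have hd : ∀ᶠ y in nhdsWithin (φ z) {φ z}ᶜ, DifferentiableAt ℂ ψ y := by
    rw [eventually_nhdsWithin_iff] at hp ⊢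
    refine hle ?_
    rw [mem_map]
    filter_upwards [hp, hzG] with w hw hwG hne
    refine (hasDerivAt_leftInvOn_of_deriv_ne_zero hG hφ hinv hwG (hw fun h => ?_)).differentiableAt
    exact hne (by rw [h]; rfl)
  have hψ := (Complex.analyticAt_of_differentiable_on_punctured_nhds_of_continuousAt hd
    hc).differentiableAt.hasDerivAt
  have hcomp := hψ.comp z han.differentiableAt.hasDerivAt
  have hid : HasDerivAt (ψ ∘ φ) 1 z := (hasDerivAt_id z).congr_of_eventuallyEq <| by
    filter_upwards [hzG] with w hw using hinv hw
  have := hcomp.unique hid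
  rw [h0, mul_zero] at this
  exact zero_ne_one this

theorem det_restrictScalars_toSpanSingleton (c : ℂ) :
    ((ContinuousLinearMap.toSpanSingleton ℂ c).restrictScalars ℝ : ℂ →L[ℝ] ℂ).det = ‖c‖ ^ 2 := by
  have h := Algebra.norm_complex_apply c
  rw [Algebra.norm_apply, Complex.normSq_eq_norm_sq] at h
  rw [← h, ContinuousLinearMap.det]
  congr 1
  exact LinearMap.ext fun x => by simp [mul_comm]

theorem hasFDerivWithinAt_real_of_differentiableOn {G : Set ℂ} {φ : ℂ → ℂ} (hG : IsOpen G)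
    (hφ : DifferentiableOn ℂ φ G) (z : ℂ) (hz : z ∈ G) : HasFDerivWithinAt φ
      ((ContinuousLinearMap.toSpanSingleton ℂ (deriv φ z)).restrictScalars ℝ : ℂ →L[ℝ] ℂ) G z :=
  ((hφ.differentiableAt (hG.mem_nhds hz)).hasDerivAt.hasFDerivAt.restrictScalars ℝ
    ).hasFDerivWithinAt

theorem memLp_two_deriv_of_bijOn {G : Set ℂ} {φ : ℂ → ℂ} {R : ℝ} (hG : IsOpen G)
    (hφ : DifferentiableOn ℂ φ G) (hbij : Set.BijOn φ G (Metric.ball 0 R)) :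
    MemLp (deriv φ) 2 (volume.restrict G) := by
  have hd : DifferentiableOn ℂ (deriv φ) G := hφ.deriv hG
  refine ⟨hd.continuousOn.aestronglyMeasurable hG.measurableSet, ?_⟩
  rw [eLpNorm_lt_top_iff_lintegral_rpow_enorm_lt_top (by norm_num) (by norm_num)]
  have h := lintegral_image_eq_lintegral_abs_det_fderiv_mul volume hG.measurableSet
    (hasFDerivWithinAt_real_of_differentiableOn hG hφ) hbij.injOn 1
  rw [hbij.image_eq] at h
  simp only [det_restrictScalars_toSpanSingleton, Pi.one_apply, mul_one, lintegral_one,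
    Measure.restrict_apply_univ] at h
  refine lt_of_eq_of_lt ?_ (measure_ball_lt_top (μ := volume) (x := (0 : ℂ)) (r := R))
  rw [h]
  refine lintegral_congr fun z => ?_
  rw [abs_of_nonneg (by positivity), ENNReal.ofReal_pow (norm_nonneg _), ofReal_norm]
  simp

theorem setIntegral_mul_conj_deriv_of_bijOn {G : Set ℂ} {φ p : ℂ → ℂ} {R : ℝ} (hR : 0 < R)
    (hG : IsOpen G) (hφ : DifferentiableOn ℂ φ G) (hbij : Set.BijOn φ G (Metric.ball 0 R))
    (hp : DifferentiableOn ℂ p G) (hp2 : MemLp p 2 (volume.restrict G)) {z₀ : ℂ} (hz₀ : z₀ ∈ G)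
    (hφ0 : φ z₀ = 0) (hφ1 : deriv φ z₀ = 1) :
    ∫ z in G, p z * (starRingEnd ℂ) (deriv φ z) = Real.pi * R ^ 2 * p z₀ := by
  set ψ := Function.invFunOn φ G
  have hinv : Set.LeftInvOn ψ φ G := hbij.injOn.leftInvOn_invFunOn
  have hd : DifferentiableOn ℂ (deriv φ) G := hφ.deriv hG
  have hne : ∀ z ∈ G, deriv φ z ≠ 0 := fun z hz => deriv_ne_zero_of_leftInvOn hG hφ hinv hz
  set g : ℂ → ℂ := fun w => p (ψ w) / deriv φ (ψ w) with hg
  have hψG : Set.MapsTo ψ (Metric.ball 0 R) G := by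
    intro w hw
    obtain ⟨z, hz, rfl⟩ := hbij.surjOn hw
    rwa [hinv hz]
  have hψd : DifferentiableOn ℂ ψ (Metric.ball 0 R) := by
    intro w hw
    obtain ⟨z, hz, rfl⟩ := hbij.surjOn hw
    exact (hasDerivAt_leftInvOn_of_deriv_ne_zero hG hφ hinv hz
      (hne z hz)).differentiableAt.differentiableWithinAt
  have hgd : DifferentiableOn ℂ g (Metric.ball 0 R) :=
    (hp.comp hψd hψG).div (hd.comp hψd hψG) fun w hw => hne _ (hψG hw)
  have hfd := hasFDerivWithinAt_real_of_differentiableOn hG hφ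
  have hpt : ∀ z ∈ G, |((ContinuousLinearMap.toSpanSingleton ℂ (deriv φ z)).restrictScalars ℝ :
      ℂ →L[ℝ] ℂ).det| • g (φ z) = p z * (starRingEnd ℂ) (deriv φ z) := by
    intro z hz
    rw [det_restrictScalars_toSpanSingleton, abs_of_nonneg (by positivity), hg]
    simp only [hinv hz, Complex.real_smul]
    rw [Complex.ofReal_pow, ← Complex.mul_conj']
    field_simp [hne z hz]
  have hprod : IntegrableOn (fun z => p z * (starRingEnd ℂ) (deriv φ z)) G := by
    have h2 := memLp_two_deriv_of_bijOn hG hφ hbij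
    exact hp2.integrable_mul (q := 2) h2.star
  have hgi : IntegrableOn g (Metric.ball 0 R) := by
    rw [← hbij.image_eq, integrableOn_image_iff_integrableOn_abs_det_fderiv_smul volume
      hG.measurableSet hfd hbij.injOn]
    exact hprod.congr_fun (fun z hz => (hpt z hz).symm) hG.measurableSet
  have h_int := integral_image_eq_integral_abs_det_fderiv_smul volume hG.measurableSet hfd
    hbij.injOn g
  rw [hbij.image_eq, setIntegral_congr_fun hG.measurableSet hpt] at h_int
  have hmv := setIntegral_radial_mul (a := 0) (R := R) (fun _ => 1) hgd
    (integrableOn_const measure_ball_lt_top.ne) (by simpa using hgi)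
  simp only [Complex.ofReal_one, one_mul] at hmv
  rw [← h_int, hmv]
  have hg0 : g 0 = p z₀ := by rw [hg, ← hφ0]; simp only [hinv hz₀, hφ1, div_one]
  rw [hg0, setIntegral_const, measureReal_def, Complex.volume_ball]
  simp [hR.le]
  ring

theorem memLp_two_polynomial_eval {G : Set ℂ} (hb : Bornology.IsBounded G) (q : Polynomial ℂ) :
    MemLp (fun z => q.eval z) 2 (volume.restrict G) := by
  refine MemLp.mono_measure (Measure.restrict_mono_set volume subset_closure) ?_
  have hc : IsCompact (closure G) := hb.isCompact_closure
  have : IsFiniteMeasure (volume.restrict (closure G)) :=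
    ⟨by rw [Measure.restrict_apply_univ]; exact hc.measure_lt_top⟩
  obtain ⟨C, hC⟩ := hc.exists_bound_of_continuousOn q.continuous.continuousOn
  exact MemLp.of_bound q.continuous.aestronglyMeasurable C
    (ae_restrict_of_forall_mem isClosed_closure.measurableSet hC)

noncomputable def polynomialToLp {G : Set ℂ} (hb : Bornology.IsBounded G) :
    Polynomial ℂ →ₗ[ℂ] Lp ℂ 2 (volume.restrict G) where
  toFun q := (memLp_two_polynomial_eval hb q).toLp _
  map_add' p q := by
    rw [← MemLp.toLp_add]
    exact MemLp.toLp_congr _ _ (Eventually.of_forall fun z => by simp)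
  map_smul' c q := by
    rw [RingHom.id_apply, ← MemLp.toLp_const_smul]
    exact MemLp.toLp_congr _ _ (Eventually.of_forall fun z => by simp)

theorem inner_toLp_toLp {G : Set ℂ} {f g : ℂ → ℂ} (hf : MemLp f 2 (volume.restrict G))
    (hg : MemLp g 2 (volume.restrict G)) :
    inner ℂ (hf.toLp f) (hg.toLp g) = ∫ z in G, g z * (starRingEnd ℂ) (f z) := by
  rw [L2.inner_def]
  refine integral_congr_ae ?_
  filter_upwards [hf.coeFn_toLp, hg.coeFn_toLp] with z h1 h2
  rw [h1, h2, RCLike.inner_apply]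

noncomputable def ballAverage (G : Set ℂ) (z : ℂ) (r : ℝ) : Lp ℂ 2 (volume.restrict G) →L[ℂ] ℂ :=
  ((volume.real (Metric.ball (0 : ℂ) r) : ℂ))⁻¹ • innerSL ℂ (indicatorConstLp 2
    (measurableSet_ball (x := z) (ε := r)) (measure_ball_lt_top (μ := volume.restrict G)).ne (1 : ℂ))

theorem volume_real_ball (z : ℂ) (r : ℝ) :
    volume.real (Metric.ball z r) = volume.real (Metric.ball (0 : ℂ) r) := by
  rw [measureReal_def, measureReal_def, Complex.volume_ball, Complex.volume_ball]

theorem ballAverage_toLp {G : Set ℂ} {f : ℂ → ℂ} {z : ℂ} {r : ℝ} (hr : 0 < r)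
    (hrG : Metric.ball z r ⊆ G) (hf : DifferentiableOn ℂ f G) (hf2 : MemLp f 2 (volume.restrict G)) :
    ballAverage G z r (hf2.toLp f) = f z := by
  have hV : volume.real (Metric.ball (0 : ℂ) r) ≠ 0 := by
    rw [measureReal_def, Complex.volume_ball]; simp [hr.ne', hr.le, Real.pi_ne_zero]
  have : IsFiniteMeasure (volume.restrict (Metric.ball z r)) :=
    ⟨by rw [Measure.restrict_apply_univ]; exact measure_ball_lt_top⟩
  have hfi : IntegrableOn f (Metric.ball z r) :=
    (hf2.mono_measure (Measure.restrict_mono_set volume hrG)).integrable (by norm_num)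
  have hmv := setIntegral_radial_mul (a := z) (R := r) (fun _ => 1) (hf.mono hrG)
    (integrableOn_const measure_ball_lt_top.ne) (by simpa using hfi)
  simp only [Complex.ofReal_one, one_mul, setIntegral_const, volume_real_ball] at hmv
  have h1 : ∫ x in Metric.ball z r, hf2.toLp f x ∂(volume.restrict G) =
      ∫ x in Metric.ball z r, f x := by
    rw [setIntegral_congr_ae measurableSet_ball (hf2.coeFn_toLp.mono fun x hx _ => hx),
      Measure.restrict_restrict measurableSet_ball, Set.inter_eq_left.2 hrG]
  rw [ballAverage, _root_.smul_apply, innerSL_apply_apply,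
    L2.inner_indicatorConstLp_one, h1, hmv, smul_eq_mul, Complex.real_smul, mul_one]
  have hV' : (volume.real (Metric.ball (0 : ℂ) r) : ℂ) ≠ 0 := by exact_mod_cast hV
  field_simp

theorem exists_norm_ballAverage_le (G : Set ℂ) (r : ℝ) :
    ∃ C : ℝ, 0 < C ∧ ∀ z F, ‖ballAverage G z r F‖ ≤ C * ‖F‖ := by
  set V := volume.real (Metric.ball (0 : ℂ) r)
  have hV : 0 ≤ V := measureReal_nonneg
  refine ⟨V⁻¹ * V ^ (1 / 2 : ℝ) + 1, by positivity, fun z F => ?_⟩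
  rw [ballAverage, _root_.smul_apply, innerSL_apply_apply, norm_smul, norm_inv,
    Complex.norm_real, Real.norm_of_nonneg hV]
  refine (mul_le_mul_of_nonneg_left (norm_inner_le_norm _ _) (inv_nonneg.2 hV)).trans ?_
  rw [norm_indicatorConstLp (by norm_num) (by norm_num), norm_one, one_mul, ← mul_assoc]
  refine mul_le_mul_of_nonneg_right ?_ (norm_nonneg _)
  refine le_trans ?_ (le_add_of_nonneg_right zero_le_one)
  refine mul_le_mul_of_nonneg_left ?_ (inv_nonneg.2 hV)
  simp only [ENNReal.toReal_ofNat]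
  refine Real.rpow_le_rpow measureReal_nonneg ?_ (by norm_num)
  rw [show V = _ from (volume_real_ball z r).symm]
  exact ENNReal.toReal_mono measure_ball_lt_top.ne (Measure.restrict_apply_le _ _)

theorem Orthonormal.summable_inner_smul {E : Type*} [NormedAddCommGroup E] [InnerProductSpace ℂ E]
    [CompleteSpace E] {v : ℕ → E} (hv : Orthonormal ℂ v) (x : E) :
    Summable fun k => inner ℂ (v k) x • v k :=
  (hv.orthogonalFamily.summable_iff_norm_sq_summable fun k => inner ℂ (v k) x).2
    (hv.inner_products_summable x)

theorem Orthonormal.inner_tsum_inner_smul {E : Type*} [NormedAddCommGroup E]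
    [InnerProductSpace ℂ E] [CompleteSpace E] {v : ℕ → E} (hv : Orthonormal ℂ v) (x : E) (j : ℕ) :
    inner ℂ (v j) (∑' k, inner ℂ (v k) x • v k) = inner ℂ (v j) x := by
  have h := (innerSL ℂ (v j)).hasSum (hv.summable_inner_smul x).hasSum
  simp only [innerSL_apply_apply] at h
  refine h.unique ?_
  convert hasSum_single j ?_ using 1
  · simp [inner_smul_right, hv.1 j]
  · intro k hk
    simp [inner_smul_right, orthonormal_iff_ite.1 hv j k, hk.symm]

theorem AreaOrthonormalPolys.span_range_eq_top {G : Set ℂ} {K : ℕ → Polynomial ℂ}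
    (hK : AreaOrthonormalPolys G K) : Submodule.span ℂ (Set.range K) = ⊤ := by
  have h0 : ∀ n, K n ≠ 0 := fun n h => by
    obtain ⟨a, ha, hl⟩ := hK.2.1 n
    rw [h, Polynomial.leadingCoeff_zero] at hl
    exact ha.ne (by exact_mod_cast hl)
  let S : Polynomial.Sequence ℂ := ⟨K, fun n => by
    rw [Polynomial.degree_eq_natDegree (h0 n), hK.1 n]⟩
  exact S.span fun n => (Polynomial.leadingCoeff_ne_zero.2 (h0 n)).isUnit

theorem AreaOrthonormalPolys.orthonormal {G : Set ℂ} {K : ℕ → Polynomial ℂ}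
    (hK : AreaOrthonormalPolys G K) (hb : Bornology.IsBounded G) :
    Orthonormal ℂ fun k => polynomialToLp hb (K k) := by
  rw [orthonormal_iff_ite]
  intro m n
  have := inner_toLp_toLp (memLp_two_polynomial_eval hb (K m)) (memLp_two_polynomial_eval hb (K n))
  rw [hK.2.2 n m] at this
  simp only [eq_comm (a := m)]
  exact this

theorem AreaOrthonormalPolys.hasSum_inner_mul_eval {G : Set ℂ} {K : ℕ → Polynomial ℂ} {f : ℂ → ℂ}
    (hK : AreaOrthonormalPolys G K) (hG : IsOpen G) (hb : Bornology.IsBounded G)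
    (hJ : ∃ γ : C(Metric.sphere (0 : ℂ) 1, ℂ), Function.Injective γ ∧ Set.range γ = frontier G)
    (hf : DifferentiableOn ℂ f G) (hf2 : MemLp f 2 (volume.restrict G)) :
    ∀ z ∈ G, HasSum
      (fun k => (∫ w in G, f w * (starRingEnd ℂ) ((K k).eval w)) * (K k).eval z) (f z) := by
  set P := polynomialToLp hb with hP
  set v : ℕ → Lp ℂ 2 (volume.restrict G) := fun k => P (K k) with hvdef
  have hv : Orthonormal ℂ v := hK.orthonormal hb
  set c : ℕ → ℂ := fun k => inner ℂ (v k) (hf2.toLp f) with hc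
  have hcint : ∀ k, c k = ∫ w in G, f w * (starRingEnd ℂ) ((K k).eval w) := fun k =>
    inner_toLp_toLp (memLp_two_polynomial_eval hb (K k)) hf2
  set S := ∑' k, c k • v k with hSdef
  have hS : HasSum (fun k => c k • v k) S := (hv.summable_inner_smul _).hasSum
  set q : Finset ℕ → Polynomial ℂ := fun t => ∑ k ∈ t, c k • K k with hq
  have hPq : ∀ t, P (q t) = ∑ k ∈ t, c k • v k := fun t => by simp [hq, hvdef, map_sum]
  have hqS : Tendsto (fun t => P (q t)) atTop (nhds S) := by
    simp only [hPq]
    exact hS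
  have hqe : ∀ t z, (q t).eval z = ∑ k ∈ t, c k * (K k).eval z := fun t z => by
    simp [hq, Polynomial.eval_finsetSum]
  have hav : ∀ (p : Polynomial ℂ) z r, 0 < r → Metric.ball z r ⊆ G →
      ballAverage G z r (P p) = p.eval z := fun p z r hr hrG =>
    ballAverage_toLp hr hrG p.differentiable.differentiableOn (memLp_two_polynomial_eval hb p)
  set s : ℂ → ℂ := fun z => ∑' k, c k * (K k).eval z with hs
  have hpt : ∀ z r, 0 < r → Metric.ball z r ⊆ G →
      HasSum (fun k => c k * (K k).eval z) (ballAverage G z r S) := by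
    intro z r hr hrG
    have h := (ballAverage G z r).hasSum hS
    simpa only [map_smul, hvdef, hav _ z r hr hrG, smul_eq_mul] using h
  have hsz : ∀ z ∈ G, HasSum (fun k => c k * (K k).eval z) (s z) := by
    intro z hz
    obtain ⟨r, hr, hrG⟩ := Metric.isOpen_iff.1 hG z hz
    exact (hpt z r hr hrG).summable.hasSum
  have hunif : TendstoLocallyUniformlyOn (fun t z => (q t).eval z) s atTop G := by
    rw [Metric.tendstoLocallyUniformlyOn_iff]
    intro ε hε x hx
    obtain ⟨r, hr, hrG⟩ := Metric.isOpen_iff.1 hG x hx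
    obtain ⟨C, hC, hCle⟩ := exists_norm_ballAverage_le G (r / 2)
    refine ⟨Metric.ball x (r / 2), mem_nhdsWithin_of_mem_nhds
      (Metric.ball_mem_nhds x (by positivity)),
      ?_⟩
    filter_upwards [Metric.tendsto_nhds.1 hqS (ε / C) (by positivity)] with t ht y hy
    have hyG : Metric.ball y (r / 2) ⊆ G := (Metric.ball_subset_ball' (by
      rw [Metric.mem_ball] at hy; linarith)).trans hrG
    have hsy : s y = ballAverage G y (r / 2) S := (hpt y (r / 2) (by positivity) hyG).tsum_eq
    rw [hsy, ← hav (q t) y (r / 2) (by positivity) hyG, dist_eq_norm, ← map_sub]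
    refine (hCle _ _).trans_lt ?_
    rw [dist_comm, dist_eq_norm, lt_div_iff₀ hC] at ht
    linarith
  have hsd : DifferentiableOn ℂ s G := hunif.differentiableOn
    (Eventually.of_forall fun t => (q t).differentiable.differentiableOn) hG
  have hsS : s =ᵐ[volume.restrict G] S := by
    have hseq : Tendsto (fun n => P (q (Finset.range n))) atTop (nhds S) :=
      hqS.comp tendsto_finset_range
    obtain ⟨ns, hns, hae⟩ := (tendstoInMeasure_of_tendsto_Lp hseq).exists_seq_tendsto_ae
    have hco : ∀ᵐ z ∂(volume.restrict G), ∀ n,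
        P (q (Finset.range n)) z = (q (Finset.range n)).eval z :=
      ae_all_iff.2 fun n => (memLp_two_polynomial_eval hb _).coeFn_toLp
    filter_upwards [hae, hco, ae_restrict_mem hG.measurableSet] with z h1 h2 hz
    simp only [h2, hqe] at h1
    exact tendsto_nhds_unique ((hsz z hz).tendsto_sum_nat.comp hns.tendsto_atTop) h1
  have hs2 : MemLp s 2 (volume.restrict G) := (memLp_congr_ae hsS).2 (Lp.memLp S)
  have hD2 := hf2.sub hs2
  have hDlp : hD2.toLp (f - s) = hf2.toLp f - S := by
    rw [MemLp.toLp_sub hf2 hs2]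
    congr 1
    exact Lp.ext (hs2.coeFn_toLp.trans hsS)
  have horth : (innerSL ℂ (hD2.toLp (f - s))).toLinearMap ∘ₗ P = 0 := by
    refine LinearMap.ext_on_range (v := K) hK.span_range_eq_top fun k => ?_
    have h1 : inner ℂ (v k) (hf2.toLp f - S) = 0 := by
      rw [inner_sub_right, hv.inner_tsum_inner_smul, sub_self]
    simp only [LinearMap.comp_apply, LinearMap.zero_apply, hDlp]
    exact inner_eq_zero_symm.1 h1
  have hzero := eq_zero_of_forall_setIntegral_conj_mul_pow_eq_zero hG hb hJ (hf.sub hsd) hD2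
    fun n => by
      have h1 := LinearMap.congr_fun horth (Polynomial.X ^ n)
      have h2 := inner_toLp_toLp hD2 (memLp_two_polynomial_eval hb (Polynomial.X ^ n))
      rw [← h2.trans (integral_congr_ae (Eventually.of_forall fun z => by simp [mul_comm]))]
      exact h1
  intro z hz
  have h0 : f z = s z := sub_eq_zero.1 (hzero z hz)
  simp only [← hcint, h0]
  exact hsz z hz

/-- The bilinear series of the Bergman kernel: for every `z ∈ G`,
`Σ_{k=0}^∞ conj(K_k(z₀)) K_k(z) = φ'(z) / (π R₀²)`. -/
theorem bergman_kernel_series_eq_deriv_conformal_map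
    (G : Set ℂ) (hG : IsJordanDomain G) (z₀ : ℂ) (hz₀ : z₀ ∈ G)
    (K : ℕ → Polynomial ℂ) (hK : AreaOrthonormalPolys G K)
    (R₀ : ℝ) (hR₀ : 0 < R₀) (φ : ℂ → ℂ)
    (hφdiff : DifferentiableOn ℂ φ G)
    (hφbij : Set.BijOn φ G (Metric.ball (0 : ℂ) R₀))
    (hφ0 : φ z₀ = 0) (hφ1 : deriv φ z₀ = 1) :
    ∀ z ∈ G,
      HasSum (fun k : ℕ => (starRingEnd ℂ) ((K k).eval z₀) * (K k).eval z)
        (deriv φ z / ((Real.pi * R₀ ^ 2 : ℝ) : ℂ)) := by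
  obtain ⟨hGo, hb, -, hJ⟩ := hG
  intro z hz
  have h := (hK.hasSum_inner_mul_eval hGo hb hJ (hφdiff.deriv hGo)
    (memLp_two_deriv_of_bijOn hGo hφdiff hφbij) z hz).div_const ((Real.pi * R₀ ^ 2 : ℝ) : ℂ)
  have hne : ((Real.pi * R₀ ^ 2 : ℝ) : ℂ) ≠ 0 := by
    exact_mod_cast (by positivity : Real.pi * R₀ ^ 2 ≠ 0)
  refine h.congr_fun fun k => ?_
  have hk := congrArg (starRingEnd ℂ) (setIntegral_mul_conj_deriv_of_bijOn hR₀ hGo hφdiff hφbij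
    (K k).differentiable.differentiableOn (memLp_two_polynomial_eval hb (K k)) hz₀ hφ0 hφ1)
  rw [← integral_conj] at hk
  simp only [map_mul, Complex.conj_conj, Complex.conj_ofReal, map_pow] at hk
  rw [show (∫ w in G, deriv φ w * (starRingEnd ℂ) ((K k).eval w)) =
    (Real.pi * R₀ ^ 2 : ℝ) * (starRingEnd ℂ) ((K k).eval z₀) by
      simpa [mul_comm] using hk]
  field_simp
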